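/- arXiv:2302.02402 — 4 statements merged into one kernel-verified Lean document; each statement's English description precedes it below -/
import Mathlib

section
/- Seiberg duality for the fundamental building block, case n ≥ m+2 (Theorem 5.3(1) / Theorem 1.6(1)): if n ≥ m + 2, then A(q) = B(q) as formal power series in K⟦q⟧. In other words, the restriction to the torus fixed point {f_1,…,f_r} of the equivariant quasimap small I-function of S^{⊕m} → Gr(r,n) equals the restriction to the complementary fixed point of the equivariant quasimap small I-function of (S^∨)^{⊕m} → Gr(n−r,n) after the substitution q' = q^{−1}. -/
open Finset

/-- Regularized ratio factor `R(x,d) = ∏_{l ≤ d}(x+l) / ∏_{l ≤ 0}(x+l)`: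
for `d ≥ 0` it is `∏_{l=1}^{d}(x+l)`, and for `d < 0` it is `(∏_{l=0}^{-d-1}(x-l))⁻¹`. -/
noncomputable def ratioR {K : Type*} [Field K] (x : K) (d : ℤ) : K :=
  if 0 ≤ d then ∏ l ∈ Finset.range d.toNat, (x + ((l : K) + 1))
  else (∏ l ∈ Finset.range (-d).toNat, (x - (l : K)))⁻¹

/-- The restriction to the torus fixed point indexed by `f` of the equivariant quasimap
small I-function of `S^{⊕m} → Gr(r,n)`, as a formal power series in the Kähler variable. -/
noncomputable def Aseries {K : Type*} [Field K] (n r m : ℕ)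
    (lam : Fin n → K) (eta : Fin m → K) (f : Fin r → Fin n) : PowerSeries K :=
  PowerSeries.mk fun N => ∑ d ∈ Finset.Nat.antidiagonalTuple r N,
    (∏ I : Fin r, ∏ J ∈ Finset.univ.filter (fun J => J ≠ I),
        ratioR (lam (f I) - lam (f J)) ((d I : ℤ) - (d J : ℤ))) *
    ∏ I : Fin r,
      (∏ a : Fin m, ∏ l ∈ Finset.range (d I), (eta a - lam (f I) - (l : K))) /
      (∏ F : Fin n, ∏ l ∈ Finset.range (d I), (lam (f I) - lam F + ((l : K) + 1)))

/-- The restriction to the complementary torus fixed point (indexed by `f'`) of the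
equivariant quasimap small I-function of `(S^∨)^{⊕m} → Gr(n-r,n)`, with the Kähler
variable `q'` substituted by `q⁻¹`. -/
noncomputable def Bseries {K : Type*} [Field K] (n r m : ℕ)
    (lam : Fin n → K) (eta : Fin m → K) (f' : Fin (n - r) → Fin n) : PowerSeries K :=
  PowerSeries.mk fun N => ∑ e ∈ Finset.Nat.antidiagonalTuple (n - r) N,
    (∏ I : Fin (n - r), ∏ J ∈ Finset.univ.filter (fun J => J ≠ I),
        ratioR (lam (f' I) - lam (f' J)) ((e J : ℤ) - (e I : ℤ))) *
    ∏ I : Fin (n - r),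
      (∏ a : Fin m, ∏ l ∈ Finset.range (e I), (eta a - lam (f' I) + ((l : K) + 1))) /
      (∏ F : Fin n, ∏ l ∈ Finset.range (e I), (lam F - lam (f' I) + ((l : K) + 1)))

theorem sd_ratioR_succ {K : Type*} [Field K] (x : K) (d : ℤ) (hx : x + 1 ≠ 0) :
    ratioR x (d + 1) = (x + 1) * ratioR (x + 1) d := by
  unfold ratioR
  rcases le_or_gt 0 d with h | h
  · obtain ⟨k, rfl⟩ := Int.eq_ofNat_of_zero_le h
    rw [if_pos (by omega), if_pos h]
    have h1 : ((k : ℤ) + 1).toNat = k + 1 := by omega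
    rw [h1, Int.toNat_natCast, Finset.prod_range_succ', mul_comm]
    congr 1
    · simp
    · refine Finset.prod_congr rfl fun l _ => ?_
      push_cast; ring
  · obtain ⟨k, rfl⟩ : ∃ k : ℕ, d = -((k : ℤ) + 1) := ⟨(-d - 1).toNat, by omega⟩
    rw [if_neg (by omega : ¬ (0 ≤ -((k : ℤ) + 1)))]
    have h1 : (- -((k : ℤ) + 1)).toNat = k + 1 := by omega
    rw [h1, Finset.prod_range_succ']
    have h3 : ∏ l ∈ Finset.range k, (x + 1 - ((l + 1 : ℕ) : K)) =
        ∏ l ∈ Finset.range k, (x - (l : K)) := by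
      refine Finset.prod_congr rfl fun l _ => ?_
      push_cast; ring
    rw [h3]
    rcases Nat.eq_zero_or_pos k with rfl | hk
    · simp [hx]
    · rw [if_neg (by omega)]
      have h2 : (-(-((k : ℤ) + 1) + 1)).toNat = k := by omega
      rw [h2, mul_inv]
      simp only [Nat.cast_zero, sub_zero]
      field_simp

/-- nonintegral -/
def sdNI {K : Type*} [Field K] (x : K) : Prop := ∀ z : ℤ, x ≠ (z : K)

/-- shuffle factor -/
noncomputable def sdG {K : Type*} [Field K] {r : ℕ} (x : Fin r → K) (d : Fin r → ℕ)
    (a b : Fin r) : K :=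
  (if b ≠ a then ratioR (x a - x b) ((d a : ℤ) - (d b : ℤ)) else 1) /
    ∏ l ∈ Finset.range (d a), (x a - x b + ((l : K) + 1))

/-- one-body factor -/
noncomputable def sdH {K : Type*} [Field K] {s : ℕ} (P : K → K) (u : Fin s → K) (z : K) (k : ℕ) : K :=
  ∏ l ∈ Finset.range k, (P (z + l) / ∏ j, (z + u j + ((l : K) + 1)))

/-- term -/
noncomputable def sdC {K : Type*} [Field K] {r s : ℕ} (P : K → K) (x : Fin r → K) (u : Fin s → K)
    (d : Fin r → ℕ) : K :=
  (∏ a, ∏ b, sdG x d a b) * ∏ a, sdH P u (x a) (d a)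

/-- sum -/
noncomputable def sdT {K : Type*} [Field K] {r s : ℕ} (P : K → K) (x : Fin r → K) (u : Fin s → K)
    (N : ℕ) : K :=
  ∑ d ∈ Finset.Nat.antidiagonalTuple r N, sdC P x u d

/-- raising coefficient -/
noncomputable def sdE {K : Type*} [Field K] {r s : ℕ} (P : K → K) (x : Fin r → K) (u : Fin s → K)
    (i : Fin r) : K :=
  P (x i) / ((∏ b ∈ Finset.univ.erase i, (x b - x i)) * ∏ j, (x i + u j + 1))

theorem sd_lagrange {K : Type*} [Field K] {r : ℕ} (x d : Fin r → K)
    (hx : Function.Injective x) :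
    ∑ i, d i * ∏ b ∈ Finset.univ.erase i, ((x b - x i + d b) / (x b - x i)) = ∑ i, d i := by
  classical
  rcases Nat.eq_zero_or_pos r with rfl | hr
  · simp
  set p : Polynomial K := ∏ b, (Polynomial.X - Polynomial.C (x b + d b)) with hp
  set q : Polynomial K := ∏ b, (Polynomial.X - Polynomial.C (x b)) with hq
  have hpm : p.Monic := Polynomial.monic_prod_X_sub_C _ _
  have hqm : q.Monic := Polynomial.monic_prod_X_sub_C _ _
  have hpd : p.degree = (r : WithBot ℕ) := by
    rw [hp, Polynomial.degree_prod]; simp only [Polynomial.degree_X_sub_C]; simp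
  have hqd : q.degree = (r : WithBot ℕ) := by simp [hq, Polynomial.degree_prod]
  have hdeg : (p - q).degree < (Finset.univ : Finset (Fin r)).card := by
    have := Polynomial.degree_sub_lt_left (hpd.trans hqd.symm) hpm.ne_zero (by rw [hpm, hqm])
    rw [hpd] at this
    simpa using this
  have h := Lagrange.coeff_eq_sum (s := Finset.univ) (v := x) hx.injOn hdeg
  have hc : 0 < (Finset.univ : Finset (Fin r)).card := by simpa using hr
  rw [Polynomial.coeff_sub, hp, hq, Polynomial.prod_X_sub_C_coeff_card_pred _ _ hc,
    Polynomial.prod_X_sub_C_coeff_card_pred _ _ hc] at h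
  have h2 : ∀ i, (p - q).eval (x i) / ∏ b ∈ Finset.univ.erase i, (x i - x b) =
      -(d i * ∏ b ∈ Finset.univ.erase i, ((x b - x i + d b) / (x b - x i))) := by
    intro i
    have hq0 : q.eval (x i) = 0 := by
      rw [hq, Polynomial.eval_prod]
      exact Finset.prod_eq_zero (Finset.mem_univ i) (by simp)
    rw [Polynomial.eval_sub, hq0, sub_zero, hp, Polynomial.eval_prod,
      ← Finset.mul_prod_erase _ _ (Finset.mem_univ i), mul_div_assoc, ← Finset.prod_div_distrib]
    have : ∀ b, Polynomial.eval (x i) (Polynomial.X - Polynomial.C (x b + d b)) / (x i - x b)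
        = (x b - x i + d b) / (x b - x i) := by
      intro b
      rw [← neg_div_neg_eq]; simp only [Polynomial.eval_sub, Polynomial.eval_X, Polynomial.eval_C]
      congr 1 <;> ring
    simp_rw [this]
    simp
  rw [← hp, ← hq] at h
  simp_rw [h2] at h
  rw [Finset.sum_neg_distrib, Finset.sum_add_distrib] at h
  linear_combination h

theorem sd_prod_corner {K : Type*} [Field K] {r : ℕ} (ρ : Fin r → Fin r → K) (i : Fin r)
    (h : ∀ a b, a ≠ i → b ≠ i → ρ a b = 1) (h' : ∀ b, b ≠ i → ρ i b = 1) :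
    ∏ a, ∏ b, ρ a b = ρ i i * ∏ a ∈ Finset.univ.erase i, ρ a i := by
  classical
  rw [← Finset.mul_prod_erase _ _ (Finset.mem_univ i)]
  congr 1
  · exact Finset.prod_eq_single i (fun b _ hb => h' b hb) (by simp)
  · refine Finset.prod_congr rfl fun a ha => ?_
    exact Finset.prod_eq_single i (fun b _ hb => h a b (Finset.ne_of_mem_erase ha) hb) (by simp)

theorem sdNI_add_int {K : Type*} [Field K] {x : K} (h : sdNI x) (z : ℤ) : x + z ≠ 0 := by
  intro h0
  apply h (-z)
  push_cast
  linear_combination h0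

theorem sdNI_add {K : Type*} [Field K] {x : K} (h : sdNI x) (z : ℤ) : sdNI (x + z) := by
  intro w hw
  apply h (w - z)
  push_cast
  linear_combination hw

theorem sdNI_neg {K : Type*} [Field K] {x : K} (h : sdNI x) : sdNI (-x) := by
  intro w hw
  apply h (-w)
  push_cast
  linear_combination -hw

theorem sd_term {K : Type*} [Field K] [CharZero K] {r s : ℕ} (P : K → K) (x : Fin r → K)
    (u : Fin s → K) (hx : ∀ a b, a ≠ b → sdNI (x a - x b))
    (d : Fin r → ℕ) (i : Fin r) :
    sdE P x u i * sdC P (x + Pi.single i 1) u d =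
      sdC P x u (d + Pi.single i 1) * (((d + Pi.single i 1 : Fin r → ℕ) i : ℕ) *
        ∏ b ∈ Finset.univ.erase i,
          ((x b - x i + ((d + Pi.single i 1 : Fin r → ℕ) b : ℕ)) / (x b - x i))) := by
  classical
  have hxi : (x + Pi.single i 1 : Fin r → K) i = x i + 1 := by simp
  have hdi : (d + Pi.single i 1 : Fin r → ℕ) i = d i + 1 := by simp
  have hxa : ∀ a, a ≠ i → (x + Pi.single i 1 : Fin r → K) a = x a := by
    intro a ha; simp [ha]
  have hda : ∀ a, a ≠ i → (d + Pi.single i 1 : Fin r → ℕ) a = d a := by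
    intro a ha; simp [ha]
  have hne : ∀ a b, a ≠ b → ∀ k : ℕ, x a - x b + k ≠ 0 := by
    intro a b hab k
    have := sdNI_add_int (hx a b hab) k
    simpa using this
  set x' := x + Pi.single i 1 with hx'
  set d' : Fin r → ℕ := d + Pi.single i 1 with hd'
  let ρ : Fin r → Fin r → K := fun a b =>
    if a = i then (if b = i then (d i + 1 : K) else 1)
    else (if b = i then (x a - x i + d a) else 1)
  have hG : ∀ a b, sdG x' d a b = sdG x d' a b * ρ a b := by
    intro a b
    by_cases ha : a = i
    · subst ha
      by_cases hb : b = a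
      · subst hb
        simp only [sdG, ρ, ne_eq, not_true_eq_false, if_false, if_true, sub_self, zero_add, hdi,
          Finset.prod_range_succ]
        have : (d b + 1 : K) ≠ 0 := Nat.cast_add_one_ne_zero _
        field_simp
      · simp only [sdG, ρ, ne_eq, hb, not_false_eq_true, if_true, if_false, hdi, hxi, hxa b hb,
          hda b hb, mul_one]
        have h1 : x a - x b + 1 ≠ 0 := by simpa using hne a b (Ne.symm hb) 1
        have h2 : (((d a + 1 : ℕ) : ℤ) - (d b : ℤ)) = ((d a : ℤ) - d b) + 1 := by push_cast; ring
        rw [h2, sd_ratioR_succ _ _ h1, Finset.prod_range_succ']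
        have h3 : x a + 1 - x b = x a - x b + 1 := by ring
        rw [h3]
        have h4 : ∏ l ∈ Finset.range (d a), (x a - x b + (((l + 1 : ℕ) : K) + 1)) =
          ∏ l ∈ Finset.range (d a), (x a - x b + 1 + ((l : K) + 1)) := by
          refine Finset.prod_congr rfl fun l _ => ?_
          push_cast; ring
        rw [h4]
        simp only [Nat.cast_zero, zero_add]
        rw [mul_comm (x a - x b + 1), mul_div_mul_right _ _ h1]
    · by_cases hb : b = i
      · subst hb
        have hba : b ≠ a := fun h => ha h.symm
        simp only [sdG, ρ, ne_eq, hba, ha, not_false_eq_true, if_true, if_false, hdi, hxi,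
          hxa a ha, hda a ha]
        have h1 : x a - (x b + 1) + 1 ≠ 0 := by
          have := hne a b ha 0
          intro h; apply this; push_cast; linear_combination h
        have h2 : (d a : ℤ) - (d b : ℤ) = ((d a : ℤ) - ((d b + 1 : ℕ) : ℤ)) + 1 := by
          push_cast; ring
        rw [h2, sd_ratioR_succ _ _ h1]
        have h3 : x a - (x b + 1) + 1 = x a - x b := by ring
        rw [h3]
        have h4 : ∀ k : ℕ, (∏ l ∈ Finset.range k, (x a - (x b + 1) + ((l : K) + 1))) *
            (x a - x b + k) = (x a - x b) * ∏ l ∈ Finset.range k, (x a - x b + ((l : K) + 1)) := by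
          intro k
          induction k with
          | zero => simp
          | succ k ih =>
            rw [Finset.prod_range_succ, Finset.prod_range_succ, ← mul_assoc, ← ih]
            push_cast; ring
        have h5 : (∏ l ∈ Finset.range (d a), (x a - x b + ((l : K) + 1))) ≠ 0 := by
          refine Finset.prod_ne_zero_iff.2 fun l _ => ?_
          have := hne a b ha (l + 1)
          simpa using this
        have h6 : (∏ l ∈ Finset.range (d a), (x a - (x b + 1) + ((l : K) + 1))) ≠ 0 := by
          refine Finset.prod_ne_zero_iff.2 fun l _ => ?_
          have := hne a b ha l
          intro h; apply this; linear_combination h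
        rw [div_mul_eq_mul_div, div_eq_div_iff h6 h5]
        linear_combination (-ratioR (x a - x b) ((d a : ℤ) - ((d b + 1 : ℕ) : ℤ))) * h4 (d a)
      · simp only [sdG, ρ, ha, hb, if_false, hxa a ha, hxa b hb, hda a ha, hda b hb, mul_one]
  have hGG : ∏ a, ∏ b, sdG x' d a b = (∏ a, ∏ b, sdG x d' a b) *
      ((d i + 1 : K) * ∏ b ∈ Finset.univ.erase i, (x b - x i + d b)) := by
    simp_rw [hG, Finset.prod_mul_distrib]
    congr 1
    rw [sd_prod_corner ρ i]
    · simp only [ρ, if_true]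
      congr 1
      refine Finset.prod_congr rfl fun b hb => ?_
      rw [if_neg (Finset.ne_of_mem_erase hb)]
    · intro a b ha hb; simp [ρ, ha, hb]
    · intro b hb; simp [ρ, hb]
  have hHH : (P (x i) / ∏ j, (x i + u j + 1)) * ∏ a, sdH P u (x' a) (d a) =
      ∏ a, sdH P u (x a) (d' a) := by
    rw [← Finset.mul_prod_erase _ _ (Finset.mem_univ i),
      ← Finset.mul_prod_erase (a := i) _ (fun a => sdH P u (x a) (d' a)) (Finset.mem_univ i),
      ← mul_assoc]
    congr 1
    · rw [hdi, hxi, sdH, sdH, Finset.prod_range_succ', mul_comm]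
      congr 1
      · refine Finset.prod_congr rfl fun l _ => ?_
        congr 1
        · congr 1; push_cast; ring
        · refine Finset.prod_congr rfl fun j _ => ?_
          push_cast; ring
      · simp
    · refine Finset.prod_congr rfl fun a ha => ?_
      rw [hxa a (Finset.ne_of_mem_erase ha), hda a (Finset.ne_of_mem_erase ha)]
  have hprod : ∏ b ∈ Finset.univ.erase i, ((x b - x i + (d' b : K)) / (x b - x i)) =
      (∏ b ∈ Finset.univ.erase i, (x b - x i + d b)) /
        ∏ b ∈ Finset.univ.erase i, (x b - x i) := by
    rw [← Finset.prod_div_distrib]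
    refine Finset.prod_congr rfl fun b hb => ?_
    rw [hda b (Finset.ne_of_mem_erase hb)]
  rw [hprod, sdC, sdC, hGG, ← hHH, sdE, hdi, div_mul_eq_div_div_swap]
  push_cast
  ring

theorem sd_rec {K : Type*} [Field K] [CharZero K] {r s : ℕ} (P : K → K) (x : Fin r → K)
    (u : Fin s → K) (hx : ∀ a b, a ≠ b → sdNI (x a - x b)) (N : ℕ) :
    ((N + 1 : ℕ) : K) * sdT P x u (N + 1) =
      ∑ i, sdE P x u i * sdT P (x + Pi.single i 1) u N := by
  classical
  have hinj : Function.Injective x := by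
    intro a b hab
    by_contra hne
    exact hx a b hne 0 (by simp [hab])
  set W : (Fin r → ℕ) → Fin r → K := fun d i => sdC P x u d * ((d i : ℕ) *
        ∏ b ∈ Finset.univ.erase i, ((x b - x i + (d b : ℕ)) / (x b - x i))) with hW
  have h1 : ((N + 1 : ℕ) : K) * sdT P x u (N + 1) =
      ∑ d ∈ Finset.Nat.antidiagonalTuple r (N + 1), ∑ i, W d i := by
    rw [sdT, Finset.mul_sum]
    refine Finset.sum_congr rfl fun d hd => ?_
    rw [Finset.Nat.mem_antidiagonalTuple] at hd
    rw [hW]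
    simp only
    rw [← Finset.mul_sum, sd_lagrange x (fun b => (d b : K)) hinj, ← hd]
    push_cast; ring
  rw [h1, Finset.sum_comm]
  refine Finset.sum_congr rfl fun i _ => ?_
  rw [sdT, Finset.mul_sum]
  symm
  refine Finset.sum_of_injOn (fun d => d + Pi.single i 1) ?_ ?_ ?_ ?_
  · intro a _ b _ hab
    exact add_right_cancel hab
  · intro d hd
    simp only [Finset.mem_coe, Finset.Nat.mem_antidiagonalTuple] at hd ⊢
    simp [Finset.sum_add_distrib, hd]
  · intro d hd hnot
    have : d i = 0 := by
      by_contra h0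
      apply hnot
      have hle : d - Pi.single i 1 + Pi.single i 1 = d := by
        ext b
        by_cases hb : b = i
        · subst hb; simp; omega
        · simp [hb]
      refine ⟨d - Pi.single i 1, ?_, hle⟩
      simp only [Finset.mem_coe, Finset.Nat.mem_antidiagonalTuple] at hd ⊢
      rw [← hle] at hd
      simp only [Pi.add_apply, Finset.sum_add_distrib] at hd
      simp at hd
      simpa using hd
    simp [hW, this]
  · intro d _
    exact sd_term P x u hx d i

theorem sd_zero {K : Type*} [Field K] {r s : ℕ} (P : K → K) (x : Fin r → K)
    (u : Fin s → K) : sdT P x u 0 = 1 := by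
  have h : ∀ a b : Fin r, sdG x 0 a b = 1 := by
    intro a b
    simp [sdG, ratioR]
  simp [sdT, Finset.Nat.antidiagonalTuple_zero_right, sdC, h, sdH]

theorem sd_base {K : Type*} [Field K] {r s : ℕ} (P : Polynomial K) (x : Fin r → K)
    (u : Fin s → K) (hx : ∀ a b, a ≠ b → sdNI (x a - x b))
    (hu : ∀ a b, a ≠ b → sdNI (u a - u b)) (hxu : ∀ a b, sdNI (x a + u b))
    (hP : P.natDegree + 2 ≤ r + s) :
    ∑ i, sdE (fun z => P.eval z) x u i = ∑ j, sdE (fun z => P.eval (-z - 1)) u x j := by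
  classical
  let v : Fin r ⊕ Fin s → K := Sum.elim x (fun j => -u j - 1)
  have hinj : Function.Injective v := by
    rintro (a | a) (b | b) hab
    · by_contra hne
      exact hx a b (fun h => hne (by rw [h])) 0 (by simp [v] at hab; simp [hab])
    · exfalso
      simp only [v, Sum.elim_inl, Sum.elim_inr] at hab
      exact hxu a b (-1) (by push_cast; linear_combination hab)
    · exfalso
      simp only [v, Sum.elim_inl, Sum.elim_inr] at hab
      exact hxu b a (-1) (by push_cast; linear_combination -hab)
    · by_contra hne
      exact hu a b (fun h => hne (by rw [h])) 0 (by simp [v] at hab; simp [hab])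
  have hcard : (Finset.univ : Finset (Fin r ⊕ Fin s)).card = r + s := by simp
  have hdeg : P.degree < (Finset.univ : Finset (Fin r ⊕ Fin s)).card := by
    rw [hcard]
    refine lt_of_le_of_lt P.degree_le_natDegree ?_
    exact_mod_cast (by omega : P.natDegree < r + s)
  have h := Lagrange.coeff_eq_sum (s := Finset.univ) (v := v) hinj.injOn hdeg
  rw [hcard, Polynomial.coeff_eq_zero_of_natDegree_lt (by omega), Fintype.sum_sum_type] at h
  have e1 : ∀ i : Fin r, ∏ j ∈ Finset.univ.erase (Sum.inl i), (v (Sum.inl i) - v j) =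
      (-1) ^ (r - 1) * ((∏ b ∈ Finset.univ.erase i, (x b - x i)) * ∏ j, (x i + u j + 1)) := by
    intro i
    have : (Finset.univ.erase (Sum.inl i) : Finset (Fin r ⊕ Fin s)) =
      (Finset.univ.erase i).disjSum Finset.univ := by
      ext (a | a) <;> simp
    rw [this, Finset.prod_disjSum, ← mul_assoc]
    congr 1
    · have : ((-1 : K)) ^ (r - 1) = ∏ b ∈ Finset.univ.erase i, (-1 : K) := by
        simp
      rw [this, ← Finset.prod_mul_distrib]
      refine Finset.prod_congr rfl fun b _ => ?_
      simp [v]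
    · refine Finset.prod_congr rfl fun b _ => ?_
      simp [v]; ring
  have e2 : ∀ i : Fin s, ∏ j ∈ Finset.univ.erase (Sum.inr i), (v (Sum.inr i) - v j) =
      (-1) ^ r * ((∏ b ∈ Finset.univ.erase i, (u b - u i)) * ∏ j, (u i + x j + 1)) := by
    intro i
    have : (Finset.univ.erase (Sum.inr i) : Finset (Fin r ⊕ Fin s)) =
      (Finset.univ).disjSum (Finset.univ.erase i) := by
      ext (a | a) <;> simp
    rw [this, Finset.prod_disjSum, mul_left_comm, mul_comm]
    congr 1
    · refine Finset.prod_congr rfl fun b _ => ?_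
      simp [v]; ring
    · have : ((-1 : K)) ^ r = ∏ b : Fin r, (-1 : K) := by
        simp
      rw [this, ← Finset.prod_mul_distrib]
      refine Finset.prod_congr rfl fun b _ => ?_
      simp [v]; ring
  simp_rw [e1, e2] at h
  rcases Nat.eq_zero_or_pos r with rfl | hr
  · simp only [Finset.univ_eq_empty, Finset.sum_empty, zero_add, pow_zero, one_mul] at h ⊢
    rw [h]
    rfl
  obtain ⟨k, rfl⟩ : ∃ k, r = k + 1 := ⟨r - 1, by omega⟩
  have hs : ((-1 : K)) ^ k * (-1) ^ k = 1 := by rw [← mul_pow]; simp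
  have h3 : ∀ (c t : K), c / ((-1) ^ k * t) = (-1) ^ k * (c / t) := by
    intro c t
    have : ((-1 : K)) ^ k ≠ 0 := pow_ne_zero _ (by simp)
    rw [div_mul_eq_div_div, div_eq_mul_inv c, eq_comm]
    have hi : ((-1 : K) ^ k)⁻¹ = (-1) ^ k := inv_eq_of_mul_eq_one_left hs
    rw [hi]; ring
  have h4 : ∀ (c t : K), c / ((-1) ^ (k + 1) * t) = - ((-1) ^ k * (c / t)) := by
    intro c t
    rw [← h3, pow_succ, mul_neg_one, neg_mul, div_neg]
  simp_rw [Nat.add_sub_cancel, h3, h4] at h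
  rw [Finset.sum_neg_distrib, ← Finset.mul_sum, ← Finset.mul_sum, ← sub_eq_add_neg, ← mul_sub] at h
  have h5 := (mul_eq_zero.1 h.symm).resolve_left (pow_ne_zero _ (by simp))
  exact sub_eq_zero.1 h5

theorem sd_comm {K : Type*} [Field K] {r s : ℕ} (P Q : K → K) (x : Fin r → K)
    (u : Fin s → K) (hxu : ∀ a b, sdNI (x a + u b)) (i : Fin r) (j : Fin s) :
    sdE P x u i * sdE Q u (x + Pi.single i 1) j = sdE Q u x j * sdE P x (u + Pi.single j 1) i := by
  classical
  have hz : ∀ k : ℕ, x i + u j + k ≠ 0 := by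
    intro k
    have := sdNI_add_int (hxu i j) k
    simpa using this
  have h1 : x i + u j + 1 ≠ 0 := by simpa using hz 1
  have h2 : x i + u j + 2 ≠ 0 := by simpa using hz 2
  have key : ∀ {t : ℕ} (w : Fin t → K) (b : Fin t) (z : K),
      ∏ c, (z + (w + Pi.single b 1 : Fin t → K) c + 1) =
        (z + w b + 2) * ∏ c ∈ Finset.univ.erase b, (z + w c + 1) := by
    intro t w b z
    rw [← Finset.mul_prod_erase _ _ (Finset.mem_univ b)]
    congr 1
    · simp; ring
    · refine Finset.prod_congr rfl fun c hc => ?_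
      simp [Finset.ne_of_mem_erase hc]
  unfold sdE
  rw [key, key, ← Finset.mul_prod_erase _ (fun c => x i + u c + 1) (Finset.mem_univ j),
    ← Finset.mul_prod_erase _ (fun c => u j + x c + 1) (Finset.mem_univ i),
    add_comm (u j) (x i), div_mul_div_comm, div_mul_div_comm]
  congr 1
  · ring
  · ring

theorem sd_main {K : Type*} [Field K] [CharZero K] {r s : ℕ} (P : Polynomial K)
    (hP : P.natDegree + 2 ≤ r + s) (N : ℕ) : ∀ (x : Fin r → K)
    (u : Fin s → K) (_ : ∀ a b, a ≠ b → sdNI (x a - x b))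
    (_ : ∀ a b, a ≠ b → sdNI (u a - u b)) (_ : ∀ a b, sdNI (x a + u b)),
    sdT (fun z => P.eval z) x u N = sdT (fun z => P.eval (-z - 1)) u x N := by
  classical
  have shift : ∀ {t : ℕ} (w : Fin t → K) (c : Fin t), (∀ a b, a ≠ b → sdNI (w a - w b)) →
      ∀ a b, a ≠ b → sdNI ((w + Pi.single c 1 : Fin t → K) a - (w + Pi.single c 1 : Fin t → K) b) := by
    intro t w c h a b hab
    have := sdNI_add (h a b hab) (((Pi.single c 1 : Fin t → ℤ) a) - (Pi.single c 1 : Fin t → ℤ) b)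
    convert this using 1
    simp only [Pi.add_apply, Pi.single_apply]
    split_ifs <;> push_cast <;> ring
  have shift2 : ∀ {t t' : ℕ} (w : Fin t → K) (w' : Fin t' → K) (c : Fin t),
      (∀ a b, sdNI (w a + w' b)) → ∀ a b, sdNI ((w + Pi.single c 1 : Fin t → K) a + w' b) := by
    intro t t' w w' c h a b
    have := sdNI_add (h a b) ((Pi.single c 1 : Fin t → ℤ) a)
    convert this using 1
    simp only [Pi.add_apply, Pi.single_apply]
    split_ifs <;> push_cast <;> ring
  have shift3 : ∀ {t t' : ℕ} (w : Fin t → K) (w' : Fin t' → K) (c : Fin t'),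
      (∀ a b, sdNI (w a + w' b)) → ∀ a b, sdNI (w a + (w' + Pi.single c 1 : Fin t' → K) b) := by
    intro t t' w w' c h a b
    have := shift2 w' w c (fun a b => by rw [add_comm]; exact h b a) b a
    rwa [add_comm]
  induction N using Nat.strong_induction_on with
  | _ N ih =>
  intro x u hx hu hxu
  match N, ih with
  | 0, _ => rw [sd_zero, sd_zero]
  | 1, _ =>
    have h1 := sd_rec (fun z => P.eval z) x u hx 0
    have h2 := sd_rec (fun z => P.eval (-z - 1)) u x hu 0
    simp only [sd_zero, mul_one] at h1 h2
    rw [sd_base P x u hx hu hxu hP, ← h2] at h1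
    simpa using h1
  | M + 2, ih =>
    set Pf : K → K := fun z => P.eval z
    set Qf : K → K := fun z => P.eval (-z - 1)
    have h1 := sd_rec Pf x u hx (M + 1)
    have h2 := sd_rec Qf u x hu (M + 1)
    have hM : ((M + 1 : ℕ) : K) ≠ 0 := Nat.cast_ne_zero.2 (Nat.succ_ne_zero M)
    have hM2 : ((M + 1 + 1 : ℕ) : K) ≠ 0 := Nat.cast_ne_zero.2 (Nat.succ_ne_zero (M + 1))
    apply mul_left_cancel₀ hM2
    apply mul_left_cancel₀ hM
    change ((M + 1 : ℕ) : K) * (((M + 1 + 1 : ℕ) : K) * sdT Pf x u (M + 1 + 1)) =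
      ((M + 1 : ℕ) : K) * (((M + 1 + 1 : ℕ) : K) * sdT Qf u x (M + 1 + 1))
    rw [h1, h2, Finset.mul_sum, Finset.mul_sum]
    have l : ∀ i, ((M + 1 : ℕ) : K) * (sdE Pf x u i * sdT Pf (x + Pi.single i 1) u (M + 1)) =
        ∑ j, sdE Pf x u i * sdE Qf u (x + Pi.single i 1) j *
          sdT Qf (u + Pi.single j 1) (x + Pi.single i 1) M := by
      intro i
      rw [ih (M + 1) (by omega) _ _ (shift x i hx) hu (shift2 x u i hxu), mul_left_comm,
        sd_rec Qf u _ hu M, Finset.mul_sum]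
      simp only [mul_assoc]
    have rr : ∀ j, ((M + 1 : ℕ) : K) * (sdE Qf u x j * sdT Qf (u + Pi.single j 1) x (M + 1)) =
        ∑ i, sdE Pf x u i * sdE Qf u (x + Pi.single i 1) j *
          sdT Qf (u + Pi.single j 1) (x + Pi.single i 1) M := by
      intro j
      rw [← ih (M + 1) (by omega) _ _ hx (shift u j hu) (shift3 x u j hxu), mul_left_comm,
        sd_rec Pf x _ hx M, Finset.mul_sum]
      refine Finset.sum_congr rfl fun i _ => ?_
      rw [ih M (by omega) _ _ (shift x i hx) (shift u j hu)
        (shift2 _ _ i (shift3 x u j hxu)), ← mul_assoc, sd_comm _ _ _ _ hxu]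
    simp_rw [l, rr]
    exact Finset.sum_comm

theorem sd_term_eq {K : Type*} [Field K] {r s n m : ℕ} (x : Fin r → K) (u : Fin s → K)
    (w : Fin n → K) (g : Fin m → K → ℕ → K) (P : K → K)
    (hP : ∀ z (l : ℕ), ∏ a, g a z l = P (z + l))
    (e : Fin r ⊕ Fin s ≃ Fin n) (he : ∀ a, w (e (Sum.inl a)) = x a)
    (he' : ∀ a, w (e (Sum.inr a)) = - u a) (d : Fin r → ℕ) :
    (∏ I : Fin r, ∏ J ∈ Finset.univ.filter (fun J => J ≠ I),
        ratioR (x I - x J) ((d I : ℤ) - (d J : ℤ))) *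
    ∏ I : Fin r,
      (∏ a : Fin m, ∏ l ∈ Finset.range (d I), g a (x I) l) /
      (∏ F : Fin n, ∏ l ∈ Finset.range (d I), (x I - w F + ((l : K) + 1))) =
    sdC P x u d := by
  classical
  rw [sdC, ← Finset.prod_mul_distrib, ← Finset.prod_mul_distrib]
  refine Finset.prod_congr rfl fun I _ => ?_
  simp only [sdG, sdH]
  rw [Finset.prod_div_distrib, Finset.prod_div_distrib, Finset.prod_filter, Finset.prod_comm,
    ← e.prod_comp, Fintype.prod_sum_type]
  simp only [he, he', hP, sub_neg_eq_add]
  rw [Finset.prod_comm (s := (Finset.univ : Finset (Fin s)))]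
  rw [div_mul_div_comm, mul_div_assoc]

/-- Seiberg duality for the fundamental building block, case `n ≥ m + 2`:
`A(q) = B(q)` in `K⟦q⟧`. -/
theorem seiberg_duality_building_block_case1 {K : Type*} [Field K] [CharZero K]
    (n r m : ℕ) (hr : 1 ≤ r) (hrn : r + 1 ≤ n) (hnm : m + 2 ≤ n)
    (lam : Fin n → K) (eta : Fin m → K)
    (hlam : ∀ i j : Fin n, i ≠ j → ∀ z : ℤ, lam i - lam j ≠ (z : K))
    (f : Fin r → Fin n) (hf : StrictMono f)
    (f' : Fin (n - r) → Fin n) (hf' : StrictMono f')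
    (hcompl : ∀ j : Fin n, (∃ i, f i = j) ↔ ¬ ∃ i, f' i = j) :
    Aseries n r m lam eta f = Bseries n r m lam eta f' := by
  classical
  have hbij : Function.Bijective (Sum.elim f f') := by
    constructor
    · rintro (a | a) (b | b) hab
      · exact congrArg _ (hf.injective hab)
      · exact absurd ⟨b, hab.symm⟩ ((hcompl (f a)).1 ⟨a, rfl⟩)
      · exact absurd ⟨a, hab⟩ ((hcompl (f b)).1 ⟨b, rfl⟩)
      · exact congrArg _ (hf'.injective hab)
    · intro j
      by_cases h : ∃ i, f i = j
      · obtain ⟨i, hi⟩ := h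
        exact ⟨Sum.inl i, hi⟩
      · have := (not_congr (hcompl j)).1 h
        obtain ⟨i, hi⟩ := not_not.1 this
        exact ⟨Sum.inr i, hi⟩
  have hne : ∀ a b, f a ≠ f' b := by
    intro a b h
    exact ((hcompl (f a)).1 ⟨a, rfl⟩) ⟨b, h.symm⟩
  let e := Equiv.ofBijective _ hbij
  let P : Polynomial K := ∏ a, (Polynomial.C (eta a) - Polynomial.X)
  have hPe : ∀ z, P.eval z = ∏ a, (eta a - z) := by
    intro z; simp [P, Polynomial.eval_prod]
  have hPd : P.natDegree ≤ m := by
    refine (Polynomial.natDegree_prod_le _ _).trans ?_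
    refine (Finset.sum_le_card_nsmul _ _ 1 fun a _ => ?_).trans (by simp)
    refine (Polynomial.natDegree_sub_le _ _).trans (by simp)
  let x : Fin r → K := fun a => lam (f a)
  let u : Fin (n - r) → K := fun a => - lam (f' a)
  have main := fun N => sd_main P (r := r) (s := n - r) (by omega) N x u
    (fun a b hab => hlam _ _ (hf.injective.ne hab))
    (fun a b hab => by
      have := sdNI_neg (hlam _ _ (hf'.injective.ne hab))
      convert this using 1
      simp only [u]; ring)
    (fun a b => by
      have : sdNI (lam (f a) - lam (f' b)) := hlam _ _ (hne a b)
      simpa [x, u, sub_eq_add_neg] using this)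
  ext N
  simp only [Aseries, Bseries, PowerSeries.coeff_mk]
  refine Eq.trans ?_ ((main N).trans ?_)
  · refine Finset.sum_congr rfl fun d _ => ?_
    exact sd_term_eq x u lam (fun a z l => eta a - z - (l : K)) (fun z => P.eval z)
      (fun z l => by simp only [hPe]; exact Finset.prod_congr rfl fun a _ => by ring)
      e (fun a => rfl) (fun a => by simp [u, e]) d
  · refine Finset.sum_congr rfl fun d _ => ?_
    rw [← sd_term_eq u x (fun F => - lam F) (fun a z l => eta a + z + ((l : K) + 1))
      (fun z => P.eval (-z - 1))
      (fun z l => by simp only [hPe]; exact Finset.prod_congr rfl fun a _ => by ring)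
      ((Equiv.sumComm _ _).trans e) (fun a => rfl) (fun a => rfl) d]
    congr 1
    · have hL : ∀ (R : Fin (n - r) → Fin (n - r) → K),
          ∏ I, ∏ J ∈ Finset.univ.filter (fun J => J ≠ I), R I J =
          ∏ I, ∏ J ∈ Finset.univ.filter (fun J => J ≠ I), R J I := by
        intro R
        simp_rw [Finset.prod_filter]
        rw [Finset.prod_comm]
        simp only [ne_comm]
      rw [hL]
      refine Finset.prod_congr rfl fun I _ => Finset.prod_congr rfl fun J _ => ?_
      congr 1
      simp only [u]; ring
    · refine Finset.prod_congr rfl fun I _ => ?_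
      congr 1
      · refine Finset.prod_congr rfl fun F _ => Finset.prod_congr rfl fun l _ => ?_
        simp only [u]; ring
      · refine Finset.prod_congr rfl fun F _ => Finset.prod_congr rfl fun l _ => ?_
        simp only [u]; ring
end

section
/- Seiberg duality for the fundamental building block, case n = m+1 (Theorem 5.3(2) / Theorem 1.6(2)): if n = m + 1, then A(q) = E(q) · B(q) in K⟦q⟧, where E(q) := Σ_{k≥0} ((−1)^{n−r})^k q^k / k! is the exponential series exp((−1)^{n−r} q). -/
open Finset

namespace SB

lemma ratio_nat {K : Type*} [Field K] (x : K) (hx : ∀ z : ℤ, x ≠ (z : K)) (k : ℕ) :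
    ratioR x (k : ℤ) * ratioR (-x) (-(k : ℤ)) * x = (-1) ^ k * (x + (k : K)) := by
  rcases Nat.eq_zero_or_pos k with rfl | hk
  · simp [ratioR]
  have h1 : ratioR x (k : ℤ) = ∏ l ∈ Finset.range k, (x + ((l : K) + 1)) := by
    simp [ratioR]
  have h2 : ratioR (-x) (-(k : ℤ)) = (∏ l ∈ Finset.range k, (-x - (l : K)))⁻¹ := by
    have : ¬ (0 : ℤ) ≤ -(k : ℤ) := by omega
    simp only [ratioR, this, if_false]
    simp
  have h3 : ∏ l ∈ Finset.range k, (-x - (l : K)) = (-1) ^ k * ∏ l ∈ Finset.range k, (x + (l : K)) := by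
    have : ∀ l ∈ Finset.range k, (-x - (l : K)) = (-1) * (x + (l : K)) := by intros; ring
    rw [Finset.prod_congr rfl this, Finset.prod_mul_distrib]
    simp
  have h4 : (∏ l ∈ Finset.range k, (x + ((l : K) + 1))) * x
      = (∏ l ∈ Finset.range k, (x + (l : K))) * (x + (k : K)) := by
    rw [← Finset.prod_range_succ (fun l : ℕ => x + (l : K)), Finset.prod_range_succ']
    simp
  have h5 : ∏ l ∈ Finset.range k, (x + (l : K)) ≠ 0 := by
    rw [Finset.prod_ne_zero_iff]
    intro l _ h
    apply hx (-(l : ℤ))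
    push_cast
    exact eq_neg_of_add_eq_zero_left h
  rw [h1, h2, h3, mul_inv]
  have h6 : ((-1 : K) ^ k)⁻¹ = (-1) ^ k := by
    rw [← inv_pow]; norm_num
  rw [h6]
  field_simp
  linear_combination h4

lemma ratio_pair {K : Type*} [Field K] (x : K) (hx : ∀ z : ℤ, x ≠ (z : K)) (d : ℤ) :
    ratioR x d * ratioR (-x) (-d) * x = (-1) ^ d.natAbs * (x + (d : K)) := by
  obtain ⟨k, rfl | rfl⟩ := Int.eq_nat_or_neg d
  · simpa using ratio_nat x hx k
  · have hx' : ∀ z : ℤ, -x ≠ (z : K) := by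
      intro z h
      apply hx (-z)
      push_cast
      rw [← h]; ring
    have := ratio_nat (-x) hx' k
    simp only [neg_neg] at this
    simp only [neg_neg, Int.natAbs_neg, Int.natAbs_natCast]
    push_cast
    linear_combination -this

lemma sign_sub {K : Type*} [Field K] (a b : ℤ) :
    ((-1 : K)) ^ (a - b).natAbs = (-1) ^ a.natAbs * (-1) ^ b.natAbs := by
  rw [← pow_add]
  have h : (a - b).natAbs % 2 = (a.natAbs + b.natAbs) % 2 := by omega
  rw [neg_one_pow_eq_pow_mod_two, h, ← neg_one_pow_eq_pow_mod_two]

lemma ratio_prod {K : Type*} [Field K] {k : ℕ} (mu : Fin k → K)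
    (hmu : ∀ i j, i ≠ j → ∀ z : ℤ, mu i - mu j ≠ (z : K)) (z : Fin k → ℤ) :
    (∏ I : Fin k, ∏ J ∈ Finset.univ.filter (fun J => J ≠ I),
        ratioR (mu I - mu J) (z I - z J)) * (Matrix.vandermonde mu).det
      = (∏ I, ((-1 : K) ^ (k - 1)) ^ (z I).natAbs) *
        (Matrix.vandermonde (fun I => mu I + (z I : K))).det := by
  have key : ∀ g : Fin k → Fin k → K, ∏ I : Fin k, ∏ J ∈ Finset.univ.filter (fun J => J ≠ I), g I J
      = ∏ I, ∏ J ∈ Finset.Ioi I, g I J * g J I := by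
    intro g
    rw [Finset.prod_prod_Ioi_mul_eq_prod_prod_off_diag (fun i j => g j i)]
    refine Finset.prod_congr rfl fun I _ => Finset.prod_congr ?_ fun _ _ => rfl
    ext; simp
  rw [Matrix.det_vandermonde, Matrix.det_vandermonde, key]
  have hs : (∏ I, ((-1 : K) ^ (k - 1)) ^ (z I).natAbs)
      = ∏ I : Fin k, ∏ J ∈ Finset.Ioi I, ((-1 : K) ^ (z I).natAbs * (-1) ^ (z J).natAbs) := by
    rw [← key (fun I J => (-1 : K) ^ (z I).natAbs)]
    refine Finset.prod_congr rfl fun I _ => ?_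
    rw [Finset.prod_const, Finset.filter_ne', Finset.card_erase_of_mem (Finset.mem_univ _)]
    simp [← pow_mul, mul_comm]
  rw [hs]
  simp only [← Finset.prod_mul_distrib]
  refine Finset.prod_congr rfl fun I _ => Finset.prod_congr rfl fun J hJ => ?_
  have hne : I ≠ J := (Finset.mem_Ioi.1 hJ).ne
  have := ratio_pair (mu I - mu J) (hmu I J hne) (z I - z J)
  rw [neg_sub, neg_sub, sign_sub] at this
  push_cast at this
  linear_combination -this

lemma coeff_prod_tuple {K : Type*} [Field K] {k : ℕ} (g : Fin k → PowerSeries K) (N : ℕ) :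
    PowerSeries.coeff N (∏ i, g i) = ∑ d ∈ Finset.Nat.antidiagonalTuple k N,
      ∏ i, PowerSeries.coeff (d i) (g i) := by
  rw [PowerSeries.coeff_prod]
  refine Finset.sum_bij' (fun l _ => (l : Fin k → ℕ)) (fun d _ => Finsupp.equivFunOnFinite.symm d)
    ?_ ?_ ?_ ?_ ?_
  · intro l hl
    simpa [Finset.Nat.mem_antidiagonalTuple] using hl
  · intro l hl
    simpa [Finset.Nat.mem_antidiagonalTuple] using hl
  · intro l hl; ext; simp
  · intro l hl; ext; simp
  · intro l hl; rfl

lemma coeff_det {K : Type*} [Field K] {k : ℕ} (x w : Fin k → ℕ → K) (N : ℕ) :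
    PowerSeries.coeff N (Matrix.det (Matrix.of fun I j : Fin k =>
        PowerSeries.mk fun d => x I d ^ (j : ℕ) * w I d)) =
      ∑ d ∈ Finset.Nat.antidiagonalTuple k N,
        (∏ I, w I (d I)) * (Matrix.vandermonde fun I => x I (d I)).det := by
  have : ∀ d : Fin k → ℕ, (∏ I, w I (d I)) * (Matrix.vandermonde fun I => x I (d I)).det
      = Matrix.det (Matrix.of fun I j : Fin k => x I (d I) ^ (j : ℕ) * w I (d I)) := by
    intro d
    rw [← Matrix.det_mul_column]
    congr 1
    ext i j
    simp [Matrix.vandermonde_apply, mul_comm]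
  simp only [this]
  rw [← Matrix.det_transpose, Matrix.det_apply]
  simp only [← Matrix.det_transpose (Matrix.of _)]
  simp only [Matrix.det_apply]
  rw [Finset.sum_comm, map_sum]
  refine Finset.sum_congr rfl fun σ _ => ?_
  rw [Units.smul_def, map_zsmul, coeff_prod_tuple, Finset.smul_sum]
  simp [Units.smul_def]

open PowerSeries in
/-- Euler operator `q d/dq`. -/
noncomputable def D (K : Type*) [Field K] : Derivation K (PowerSeries K) (PowerSeries K) :=
  (PowerSeries.X : PowerSeries K) • PowerSeries.derivative K

lemma coeff_D {K : Type*} [Field K] (p : PowerSeries K) (d : ℕ) :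
    PowerSeries.coeff d (D K p) = (d : K) * PowerSeries.coeff d p := by
  have : D K p = PowerSeries.X * PowerSeries.derivative K p := rfl
  rw [this]
  cases d with
  | zero => simp
  | succ d =>
    rw [PowerSeries.coeff_succ_X_mul, PowerSeries.coeff_derivative]
    push_cast; ring

lemma D_mul {K : Type*} [Field K] (a b : PowerSeries K) :
    D K (a * b) = a * D K b + b * D K a := by
  simp [Derivation.leibniz]

lemma D_prod {K : Type*} [Field K] {ι : Type*} [DecidableEq ι] (s : Finset ι)
    (a l : ι → PowerSeries K) :
    D K (∏ i ∈ s, a i) + (∑ i ∈ s, l i) * ∏ i ∈ s, a i =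
      ∑ i ∈ s, (D K (a i) + l i * a i) * ∏ j ∈ s.erase i, a j := by
  induction s using Finset.induction_on with
  | empty => simp
  | insert x s hx ih =>
    rw [Finset.prod_insert hx, Finset.sum_insert hx, Finset.sum_insert hx, D_mul,
      Finset.erase_insert hx]
    have : ∀ i ∈ s, (D K (a i) + l i * a i) * ∏ j ∈ (insert x s).erase i, a j
        = a x * ((D K (a i) + l i * a i) * ∏ j ∈ s.erase i, a j) := by
      intro i hi
      have hxi : x ≠ i := by rintro rfl; exact hx hi
      rw [Finset.erase_insert_of_ne hxi, Finset.prod_insert (by simp [hx])]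
      ring
    rw [Finset.sum_congr rfl this, ← Finset.mul_sum, ← ih]
    ring

lemma abel {K : Type*} [Field K] {ι : Type*} [DecidableEq ι] [Fintype ι]
    (M C : Matrix ι ι (PowerSeries K)) (l : ι → PowerSeries K)
    (h : ∀ F c, D K (M F c) + l F * M F c = ∑ c', C c' c * M F c') :
    D K M.det + (∑ F, l F) * M.det = (∑ c, C c c) * M.det := by
  have h1 : ∀ c, (M.updateCol c (fun k => ∑ i, C i c • M k i)).det = C c c * M.det := by
    intro c
    simpa using Matrix.det_updateCol_sum M c (fun i => C i c)
  rw [Finset.sum_mul (Finset.univ) (fun c => C c c)]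
  simp only [← h1]
  have h2 : ∀ c, (M.updateCol c (fun k => ∑ i, C i c • M k i)).det =
      ∑ σ : Equiv.Perm ι, Equiv.Perm.sign σ • ((D K (M (σ c) c) + l (σ c) * M (σ c) c) *
        ∏ j ∈ Finset.univ.erase c, M (σ j) j) := by
    intro c
    rw [Matrix.det_apply]
    refine Finset.sum_congr rfl fun σ _ => ?_
    congr 1
    rw [← Finset.mul_prod_erase _ _ (Finset.mem_univ c)]
    congr 1
    · simp [h]
    · refine Finset.prod_congr rfl fun j hj => ?_
      rw [Matrix.updateCol_ne (Finset.ne_of_mem_erase hj)]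
  simp only [h2]
  rw [Finset.sum_comm, Matrix.det_apply, map_sum, Finset.mul_sum, ← Finset.sum_add_distrib]
  refine Finset.sum_congr rfl fun σ _ => ?_
  rw [← Finset.smul_sum, ← D_prod Finset.univ (fun i => M (σ i) i) (fun i => l (σ i)),
    Equiv.sum_comp σ l]
  simp only [Units.smul_def, map_zsmul, smul_add, mul_smul_comm]

lemma euler_exp {K : Type*} [Field K] [CharZero K] (c : K) (W : PowerSeries K)
    (h : D K W = PowerSeries.C c * PowerSeries.X * W) :
    W = PowerSeries.C (PowerSeries.coeff 0 W) *
      PowerSeries.mk fun k => c ^ k / (Nat.factorial k : K) := by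
  ext d
  rw [PowerSeries.coeff_C_mul, PowerSeries.coeff_mk]
  induction d with
  | zero => simp
  | succ d ih =>
    have := congrArg (PowerSeries.coeff (d + 1)) h
    rw [coeff_D, mul_assoc, PowerSeries.coeff_C_mul, PowerSeries.coeff_succ_X_mul, ih] at this
    have h0 : ((d + 1 : ℕ) : K) ≠ 0 := Nat.cast_ne_zero.2 (Nat.succ_ne_zero d)
    have h1 : ((Nat.factorial d : ℕ) : K) ≠ 0 := Nat.cast_ne_zero.2 (Nat.factorial_ne_zero d)
    apply mul_left_cancel₀ h0
    rw [this, Nat.factorial_succ]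
    push_cast at h0 ⊢
    field_simp
    try ring

lemma euler_zero {K : Type*} [Field K] (x : K) (hx : ∀ z : ℤ, x ≠ (z : K)) (y : PowerSeries K)
    (h : D K y = PowerSeries.C x * y) : y = 0 := by
  ext d
  have := congrArg (PowerSeries.coeff d) h
  rw [coeff_D, PowerSeries.coeff_C_mul] at this
  have h2 : ((d : K) - x) * PowerSeries.coeff d y = 0 := by linear_combination this
  rcases mul_eq_zero.1 h2 with h3 | h3
  · exact absurd (by push_cast; linear_combination -h3) (hx (d : ℤ))
  · simpa using h3

lemma euler_const {K : Type*} [Field K] [CharZero K] (y : PowerSeries K)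
    (h : D K y = 0) : y = PowerSeries.C (PowerSeries.coeff 0 y) := by
  ext d
  have := congrArg (PowerSeries.coeff d) h
  rw [coeff_D] at this
  cases d with
  | zero => simp
  | succ d =>
    rw [map_zero] at this
    rw [PowerSeries.coeff_C, if_neg (Nat.succ_ne_zero d)]
    rcases mul_eq_zero.1 this with h3 | h3
    · exact absurd h3 (Nat.cast_ne_zero.2 (Nat.succ_ne_zero d))
    · exact h3

/-- `θ^i w`. -/
noncomputable def U {K : Type*} [Field K] (x : K) (w : ℕ → K) (i : ℕ) : PowerSeries K :=
  PowerSeries.mk fun d => (x + (d : K)) ^ i * w d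

/-- `ψ^i v`. -/
noncomputable def V {K : Type*} [Field K] (x : K) (v : ℕ → K) (i : ℕ) : PowerSeries K :=
  PowerSeries.mk fun d => (x - (d : K)) ^ i * v d

lemma D_U {K : Type*} [Field K] (x : K) (w : ℕ → K) (i : ℕ) :
    D K (U x w i) + PowerSeries.C x * U x w i = U x w (i + 1) := by
  ext d
  rw [map_add, coeff_D, PowerSeries.coeff_C_mul]
  simp only [U, PowerSeries.coeff_mk]
  ring

lemma D_V {K : Type*} [Field K] (x : K) (w : ℕ → K) (i : ℕ) :
    PowerSeries.C x * V x w i - D K (V x w i) = V x w (i + 1) := by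
  ext d
  rw [map_sub, coeff_D, PowerSeries.coeff_C_mul]
  simp only [V, PowerSeries.coeff_mk]
  ring

/-- Adjoint sequence. -/
noncomputable def Y {K : Type*} [Field K] (n : ℕ) (b : ℕ → PowerSeries K) (x : K) (v : ℕ → K) :
    ℕ → PowerSeries K
  | 0 => V x v 0
  | j + 1 => PowerSeries.C x * Y n b x v j - D K (Y n b x v j) - b (n - 1 - j) * V x v 0

lemma coeff_Y {K : Type*} [Field K] (n : ℕ) (b : ℕ → PowerSeries K) (x : K) (v : ℕ → K)
    (j e : ℕ) : PowerSeries.coeff e (Y n b x v j) = (x - (e : K)) ^ j * v e -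
      ∑ i ∈ Finset.range j, (x - (e : K)) ^ (j - 1 - i) *
        PowerSeries.coeff e (b (n - 1 - i) * V x v 0) := by
  induction j with
  | zero => simp [Y, V]
  | succ j ih =>
    rw [Y, map_sub, map_sub, coeff_D, PowerSeries.coeff_C_mul, ih, Finset.sum_range_succ]
    have : ∑ i ∈ Finset.range j, (x - (e : K)) ^ (j + 1 - 1 - i) *
        PowerSeries.coeff e (b (n - 1 - i) * V x v 0) = (x - (e : K)) *
        ∑ i ∈ Finset.range j, (x - (e : K)) ^ (j - 1 - i) *
        PowerSeries.coeff e (b (n - 1 - i) * V x v 0) := by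
      rw [Finset.mul_sum]
      refine Finset.sum_congr rfl fun i hi => ?_
      have hi := Finset.mem_range.1 hi
      rw [show j + 1 - 1 - i = (j - 1 - i) + 1 by omega]
      ring
    rw [this]
    simp
    ring

lemma Y_n {K : Type*} [Field K] (n : ℕ) (b : ℕ → PowerSeries K) (x : K) (v : ℕ → K)
    (h : ∀ e : ℕ, (x - (e : K)) ^ n * v e =
      ∑ k ∈ Finset.range n, (x - (e : K)) ^ k * PowerSeries.coeff e (b k * V x v 0)) :
    Y n b x v n = 0 := by
  ext e
  rw [coeff_Y, h e, Finset.sum_range_reflect (fun k => (x - (e : K)) ^ k *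
    PowerSeries.coeff e (b k * V x v 0))]
  simp

lemma D_pair {K : Type*} [Field K] (n : ℕ) (b : ℕ → PowerSeries K) (x x' : K) (w v : ℕ → K)
    (hU : U x w n = ∑ k ∈ Finset.range n, b k * U x w k) (hY : Y n b x' v n = 0) :
    D K (∑ i ∈ Finset.range n, U x w i * Y n b x' v (n - 1 - i)) =
      PowerSeries.C (x' - x) * ∑ i ∈ Finset.range n, U x w i * Y n b x' v (n - 1 - i) := by
  have h1 : ∀ i ∈ Finset.range n, D K (U x w i * Y n b x' v (n - 1 - i)) =
      PowerSeries.C (x' - x) * (U x w i * Y n b x' v (n - 1 - i)) +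
      (U x w (i + 1) * Y n b x' v (n - (i + 1)) - U x w i * Y n b x' v (n - i)) -
      V x' v 0 * (b i * U x w i) := by
    intro i hi
    have hi := Finset.mem_range.1 hi
    have e1 : n - i = (n - 1 - i) + 1 := by omega
    have e2 : n - (i + 1) = n - 1 - i := by omega
    have e3 : n - 1 - (n - 1 - i) = i := by omega
    rw [D_mul, e1, e2, Y, e3, ← D_U, map_sub]
    ring
  rw [map_sum, Finset.sum_congr rfl h1, Finset.sum_sub_distrib, Finset.sum_add_distrib,
    ← Finset.mul_sum, ← Finset.mul_sum, ← hU,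
    Finset.sum_range_sub (fun i => U x w i * Y n b x' v (n - i))]
  simp [hY, Y]
  ring

/-- Triangular change of basis. -/
noncomputable def T {K : Type*} [Field K] (n : ℕ) (b : ℕ → PowerSeries K) :
    ℕ → ℕ → PowerSeries K
  | 0, k => if k = 0 then 1 else 0
  | j + 1, 0 => - D K (T n b j 0) - b (n - 1 - j)
  | j + 1, k + 1 => T n b j k - D K (T n b j (k + 1))

lemma T_gt {K : Type*} [Field K] (n : ℕ) (b : ℕ → PowerSeries K) (j : ℕ) :
    ∀ k, j < k → T n b j k = 0 := by
  induction j with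
  | zero => intro k hk; simp [T, hk.ne']
  | succ j ih =>
    intro k hk
    cases k with
    | zero => omega
    | succ k => rw [T, ih k (by omega), ih (k + 1) (by omega)]; simp

lemma T_diag {K : Type*} [Field K] (n : ℕ) (b : ℕ → PowerSeries K) (j : ℕ) :
    T n b j j = 1 := by
  induction j with
  | zero => simp [T]
  | succ j ih => rw [T, ih, T_gt n b j (j + 1) (by omega)]; simp

lemma Y_eq {K : Type*} [Field K] (n : ℕ) (b : ℕ → PowerSeries K) (x : K) (v : ℕ → K) (j : ℕ) :
    Y n b x v j = ∑ k ∈ Finset.range (j + 1), T n b j k * V x v k := by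
  induction j with
  | zero => simp [Y, T]
  | succ j ih =>
    rw [Finset.sum_range_succ', Y, ih]
    simp only [T]
    simp only [sub_mul, Finset.sum_sub_distrib]
    have h0 : ∑ k ∈ Finset.range (j + 1), D K (T n b j (k + 1)) * V x v (k + 1)
        + D K (T n b j 0) * V x v 0 = ∑ k ∈ Finset.range (j + 1), D K (T n b j k) * V x v k := by
      rw [← Finset.sum_range_succ' (fun k => D K (T n b j k) * V x v k), Finset.sum_range_succ,
        T_gt n b j (j + 1) (by omega)]
      simp
    have h1 : PowerSeries.C x * ∑ k ∈ Finset.range (j + 1), T n b j k * V x v k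
        - D K (∑ k ∈ Finset.range (j + 1), T n b j k * V x v k)
        = ∑ k ∈ Finset.range (j + 1), T n b j k * V x v (k + 1)
          - ∑ k ∈ Finset.range (j + 1), D K (T n b j k) * V x v k := by
      rw [Finset.mul_sum, map_sum, ← Finset.sum_sub_distrib, ← Finset.sum_sub_distrib]
      refine Finset.sum_congr rfl fun k _ => ?_
      rw [D_mul, ← D_V]; ring
    rw [h1, ← h0]
    ring

/-- Column labels. -/
def kap {r s : ℕ} (n : ℕ) : Fin r ⊕ Fin s → ℕ
  | Sum.inl j => j
  | Sum.inr j => n - 1 - j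

lemma kap_lt {r s n : ℕ} (hn : n = r + s) (c : Fin r ⊕ Fin s) : kap n c < n := by
  rcases c with j | j
  · have := j.2; simp only [kap]; omega
  · have := j.2; simp only [kap]; omega

lemma kap_inj {r s n : ℕ} (hn : n = r + s) :
    Function.Injective (kap n : Fin r ⊕ Fin s → ℕ) := by
  rintro (i | i) (j | j) h <;> have := i.2 <;> have := j.2 <;> simp only [kap] at h
  · congr 1; ext; exact h
  · omega
  · omega
  · congr 1; ext; omega

lemma sum_kap {R : Type*} [AddCommMonoid R] {r s n : ℕ} (hn : n = r + s) (h : ℕ → R) :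
    ∑ c : Fin r ⊕ Fin s, h (kap n c) = ∑ i ∈ Finset.range n, h i := by
  have himg : (Finset.univ : Finset (Fin r ⊕ Fin s)).image (kap n) = Finset.range n := by
    apply Finset.eq_of_subset_of_card_le
    · intro i hi
      obtain ⟨c, _, rfl⟩ := Finset.mem_image.1 hi
      exact Finset.mem_range.2 (kap_lt hn c)
    · rw [Finset.card_image_of_injective _ (kap_inj hn)]
      simp [hn]
  rw [← himg, Finset.sum_image (fun a _ b _ hab => kap_inj hn hab)]

lemma vand_ne {K : Type*} [Field K] {r s n : ℕ} (hn : n = r + s) (x : Fin r ⊕ Fin s → K)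
    (hx : Function.Injective x) :
    (Matrix.of fun F c : Fin r ⊕ Fin s => x F ^ kap n c).det ≠ 0 := by
  have hcard : Fintype.card (Fin r ⊕ Fin s) = Fintype.card (Fin n) := by simp [hn]
  let e : Fin r ⊕ Fin s ≃ Fin n := Equiv.ofBijective (fun c => (⟨kap n c, kap_lt hn c⟩ : Fin n))
    ((Fintype.bijective_iff_injective_and_card _).2
      ⟨fun a b h => kap_inj hn (congrArg Fin.val h), hcard⟩)
  have h : (Matrix.of fun F c : Fin r ⊕ Fin s => x F ^ kap n c)
      = (Matrix.vandermonde (fun i => x (e.symm i))).submatrix e e := by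
    ext F c
    simp [Matrix.vandermonde_apply]
    rfl
  rw [h, Matrix.det_submatrix_equiv_self, Matrix.det_vandermonde_ne_zero_iff]
  exact hx.comp e.symm.injective

theorem core {K : Type*} [Field K] [CharZero K] {r s n : ℕ} (hn : n = r + s) (hpos : 0 < n)
    (x : Fin r ⊕ Fin s → K) (hx : ∀ i j, i ≠ j → ∀ z : ℤ, x i - x j ≠ (z : K))
    (w v : Fin r ⊕ Fin s → ℕ → K) (hw0 : ∀ F, w F 0 = 1) (b : ℕ → PowerSeries K) (c : K)
    (hU : ∀ F, U (x F) (w F) n = ∑ k ∈ Finset.range n, b k * U (x F) (w F) k)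
    (hY : ∀ F, Y n b (x F) (v F) n = 0)
    (hb : b (n - 1) = PowerSeries.C (∑ F, x F) + PowerSeries.C c * PowerSeries.X) :
    ∃ W0 k : K, W0 ≠ 0 ∧
      (Matrix.of fun i j : Fin r => U (x (Sum.inl i)) (w (Sum.inl i)) j).det * PowerSeries.C k =
      PowerSeries.C W0 * (PowerSeries.mk fun k => c ^ k / (Nat.factorial k : K)) *
        (Matrix.of fun i j : Fin s => V (x (Sum.inr i)) (v (Sum.inr i)) j).det := by
  have hinj : Function.Injective x := by
    intro i j h
    by_contra hne
    exact hx i j hne 0 (by simp [h])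
  set M : Matrix (Fin r ⊕ Fin s) (Fin r ⊕ Fin s) (PowerSeries K) :=
    Matrix.of fun F c => U (x F) (w F) (kap n c) with hM
  have hW : D K M.det = PowerSeries.C c * PowerSeries.X * M.det := by
    have h := abel M (Matrix.of fun c' c => if kap n c + 1 < n then
        (if kap n c' = kap n c + 1 then 1 else 0) else b (kap n c'))
      (fun F => PowerSeries.C (x F)) (by
        intro F c
        simp only [hM, Matrix.of_apply]
        rw [D_U, sum_kap hn (fun i => (if kap n c + 1 < n then
          (if i = kap n c + 1 then 1 else 0) else b i) * U (x F) (w F) i)]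
        split_ifs with h1
        · simp [Finset.sum_ite_eq', h1]
        · have : kap n c + 1 = n := by have := kap_lt hn c; omega
          rw [this, hU])
    simp only [Matrix.of_apply] at h
    rw [sum_kap hn (fun i => (if i + 1 < n then
          (if i = i + 1 then 1 else 0) else b i)),
      Finset.sum_eq_single_of_mem (n - 1) (Finset.mem_range.2 (by omega))
        (by
          intro i hi hne
          have := Finset.mem_range.1 hi
          rw [if_pos (by omega), if_neg (by omega)]),
      if_neg (by omega), hb, map_sum] at h
    linear_combination h
  have hW' := euler_exp c _ hW
  refine ⟨PowerSeries.coeff 0 M.det, ∏ i : Fin s, PowerSeries.coeff 0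
    (∑ k ∈ Finset.range n, U (x (Sum.inr i)) (w (Sum.inr i)) k *
      Y n b (x (Sum.inr i)) (v (Sum.inr i)) (n - 1 - k)), ?_, ?_⟩
  · have : PowerSeries.coeff 0 M.det
        = (Matrix.of fun F c : Fin r ⊕ Fin s => x F ^ kap n c).det := by
      rw [PowerSeries.coeff_zero_eq_constantCoeff, RingHom.map_det]
      congr 1
      ext F c
      simp [hM, U, hw0, ← PowerSeries.coeff_zero_eq_constantCoeff]
    rw [this]
    exact vand_ne hn x hinj
  rw [← hW']
  -- the adjoint block
  set X12 : Matrix (Fin r) (Fin s) (PowerSeries K) :=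
    Matrix.of fun j i => Y n b (x (Sum.inr i)) (v (Sum.inr i)) (n - 1 - kap (s := s) n (Sum.inl j))
    with hX12
  set X22 : Matrix (Fin s) (Fin s) (PowerSeries K) :=
    Matrix.of fun j i => Y n b (x (Sum.inr i)) (v (Sum.inr i)) (n - 1 - kap (r := r) n (Sum.inr j))
    with hX22
  have hdet22 : X22.det = (Matrix.of fun i j : Fin s => V (x (Sum.inr i)) (v (Sum.inr i)) j).det := by
    have : X22 = (Matrix.of fun j k : Fin s => T n b j k) *
        (Matrix.of fun i j : Fin s => V (x (Sum.inr i)) (v (Sum.inr i)) j).transpose := by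
      ext1 j i
      rw [Matrix.mul_apply]
      simp only [hX22, Matrix.of_apply, Matrix.transpose_apply, kap]
      have hj := j.2
      rw [show n - 1 - (n - 1 - (j : ℕ)) = j by omega, Y_eq,
        Fin.sum_univ_eq_sum_range (fun k => T n b j k * V (x (Sum.inr i)) (v (Sum.inr i)) k)]
      apply Finset.sum_subset
      · intro k hk
        simp only [Finset.mem_range] at hk ⊢
        omega
      · intro k _ hk
        simp only [Finset.mem_range] at hk
        rw [T_gt n b j k (by omega), zero_mul]
    rw [this, Matrix.det_mul, Matrix.det_transpose, Matrix.det_of_isLowerTriangular]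
    · simp [T_diag]
    · intro i j hij
      have hij : i < j := hij
      simp only [Matrix.of_apply]
      exact T_gt n b i j hij
  have hpair : ∀ F i, (∑ c : Fin r ⊕ Fin s, M F c *
      Y n b (x (Sum.inr i)) (v (Sum.inr i)) (n - 1 - kap n c)) =
      if F = Sum.inr i then PowerSeries.C (PowerSeries.coeff 0
        (∑ k ∈ Finset.range n, U (x (Sum.inr i)) (w (Sum.inr i)) k *
        Y n b (x (Sum.inr i)) (v (Sum.inr i)) (n - 1 - k))) else 0 := by
    intro F i
    simp only [hM, Matrix.of_apply]
    rw [sum_kap hn (fun k => U (x F) (w F) k *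
      Y n b (x (Sum.inr i)) (v (Sum.inr i)) (n - 1 - k))]
    have h := D_pair n b (x F) (x (Sum.inr i)) (w F) (v (Sum.inr i)) (hU F) (hY _)
    split_ifs with hF
    · subst hF
      apply euler_const
      simpa using h
    · exact euler_zero _ (hx _ _ (Ne.symm hF)) _ h
  have hmul : M * Matrix.fromBlocks 1 X12 0 X22 =
      Matrix.fromBlocks (Matrix.of fun i j : Fin r => U (x (Sum.inl i)) (w (Sum.inl i)) j) 0
        (Matrix.of fun (i : Fin s) (j : Fin r) => U (x (Sum.inr i)) (w (Sum.inr i)) j)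
        (Matrix.diagonal fun i : Fin s => PowerSeries.C (PowerSeries.coeff 0
          (∑ k ∈ Finset.range n, U (x (Sum.inr i)) (w (Sum.inr i)) k *
          Y n b (x (Sum.inr i)) (v (Sum.inr i)) (n - 1 - k)))) := by
    ext1 F c
    rw [Matrix.mul_apply]
    rcases c with c | c
    · rw [Fintype.sum_sum_type]
      rcases F with F | F <;> simp [hM, Matrix.one_apply, kap]
    · have h := hpair F c
      rw [Fintype.sum_sum_type] at h ⊢
      rcases F with F | F
      · simpa [hX12, hX22] using h
      · rw [Matrix.fromBlocks_apply₂₂, Matrix.diagonal_apply]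
        simp only [Matrix.fromBlocks_apply₁₂, Matrix.fromBlocks_apply₂₂, hX12, hX22,
          Matrix.of_apply, h, Sum.inr.injEq]
        split_ifs with hFc
        · rw [hFc]
        · rfl
  have := congrArg Matrix.det hmul
  rw [Matrix.det_mul, Matrix.det_fromBlocks_zero₂₁, Matrix.det_fromBlocks_zero₁₂,
    Matrix.det_one, one_mul, Matrix.det_diagonal, hdet22] at this
  rw [map_prod, ← this]

lemma hU_of {K : Type*} [Field K] {n : ℕ} (P Q : Polynomial K) (hP : P.Monic)
    (hPn : P.natDegree = n) (hQ : Q.natDegree < n) (c x : K) (w : ℕ → K)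
    (h0 : P.eval x = 0)
    (h : ∀ d : ℕ, P.eval (x + ((d : K) + 1)) * w (d + 1) = c * Q.eval (x + (d : K)) * w d) :
    U x w n = ∑ k ∈ Finset.range n, (PowerSeries.C (-P.coeff k) +
      PowerSeries.C (c * Q.coeff k) * PowerSeries.X) * U x w k := by
  have hPe : ∀ y, P.eval y = ∑ k ∈ Finset.range n, P.coeff k * y ^ k + y ^ n := by
    intro y
    rw [Polynomial.eval_eq_sum_range, Finset.sum_range_succ, hP.coeff_natDegree, hPn, one_mul]
  have hQe : ∀ y, Q.eval y = ∑ k ∈ Finset.range n, Q.coeff k * y ^ k :=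
    fun y => Polynomial.eval_eq_sum_range' hQ y
  ext d
  rw [map_sum]
  cases d with
  | zero =>
    have : ∀ k ∈ Finset.range n, PowerSeries.coeff 0 ((PowerSeries.C (-P.coeff k) +
      PowerSeries.C (c * Q.coeff k) * PowerSeries.X) * U x w k) = -w 0 * (P.coeff k * x ^ k) := by
      intro k _
      rw [add_mul, mul_assoc, map_add, PowerSeries.coeff_C_mul, PowerSeries.coeff_C_mul,
        PowerSeries.coeff_zero_X_mul]
      simp only [U, PowerSeries.coeff_mk]
      push_cast
      rw [add_zero]
      ring
    rw [Finset.sum_congr rfl this, ← Finset.mul_sum]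
    simp only [U, PowerSeries.coeff_mk]
    rw [hPe] at h0
    push_cast
    rw [add_zero]
    linear_combination (w 0) * h0
  | succ d =>
    have : ∀ k ∈ Finset.range n, PowerSeries.coeff (d + 1) ((PowerSeries.C (-P.coeff k) +
      PowerSeries.C (c * Q.coeff k) * PowerSeries.X) * U x w k) =
        -w (d + 1) * (P.coeff k * (x + ((d : K) + 1)) ^ k) +
        c * w d * (Q.coeff k * (x + (d : K)) ^ k) := by
      intro k _
      rw [add_mul, mul_assoc, map_add, PowerSeries.coeff_C_mul, PowerSeries.coeff_C_mul,
        PowerSeries.coeff_succ_X_mul]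
      simp only [U, PowerSeries.coeff_mk]
      push_cast
      ring
    rw [Finset.sum_congr rfl this, Finset.sum_add_distrib, ← Finset.mul_sum, ← Finset.mul_sum,
      ← hQe]
    simp only [U, PowerSeries.coeff_mk]
    have h := h d
    rw [hPe] at h
    push_cast
    linear_combination h

lemma hY_of {K : Type*} [Field K] {n : ℕ} (P Q : Polynomial K) (hP : P.Monic)
    (hPn : P.natDegree = n) (hQ : Q.natDegree < n) (c x : K) (v : ℕ → K)
    (h0 : P.eval x = 0)
    (h : ∀ d : ℕ, P.eval (x - ((d : K) + 1)) * v (d + 1) =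
      c * Q.eval (x - ((d : K) + 1)) * v d) :
    Y n (fun k => PowerSeries.C (-P.coeff k) +
      PowerSeries.C (c * Q.coeff k) * PowerSeries.X) x v n = 0 := by
  have hPe : ∀ y, P.eval y = ∑ k ∈ Finset.range n, P.coeff k * y ^ k + y ^ n := by
    intro y
    rw [Polynomial.eval_eq_sum_range, Finset.sum_range_succ, hP.coeff_natDegree, hPn, one_mul]
  have hQe : ∀ y, Q.eval y = ∑ k ∈ Finset.range n, Q.coeff k * y ^ k :=
    fun y => Polynomial.eval_eq_sum_range' hQ y
  apply Y_n
  intro d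
  cases d with
  | zero =>
    have : ∀ k ∈ Finset.range n, (x - ((0 : ℕ) : K)) ^ k *
      PowerSeries.coeff 0 ((PowerSeries.C (-P.coeff k) +
      PowerSeries.C (c * Q.coeff k) * PowerSeries.X) * V x v 0) = -v 0 * (P.coeff k * x ^ k) := by
      intro k _
      rw [add_mul, mul_assoc, map_add, PowerSeries.coeff_C_mul, PowerSeries.coeff_C_mul,
        PowerSeries.coeff_zero_X_mul]
      simp only [V, PowerSeries.coeff_mk]
      push_cast
      rw [sub_zero]
      ring
    rw [Finset.sum_congr rfl this, ← Finset.mul_sum]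
    rw [hPe] at h0
    push_cast
    rw [sub_zero]
    linear_combination (v 0) * h0
  | succ d =>
    have : ∀ k ∈ Finset.range n, (x - ((d + 1 : ℕ) : K)) ^ k *
      PowerSeries.coeff (d + 1) ((PowerSeries.C (-P.coeff k) +
      PowerSeries.C (c * Q.coeff k) * PowerSeries.X) * V x v 0) =
        -v (d + 1) * (P.coeff k * (x - ((d : K) + 1)) ^ k) +
        c * v d * (Q.coeff k * (x - ((d : K) + 1)) ^ k) := by
      intro k _
      rw [add_mul, mul_assoc, map_add, PowerSeries.coeff_C_mul, PowerSeries.coeff_C_mul,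
        PowerSeries.coeff_succ_X_mul]
      simp only [V, PowerSeries.coeff_mk]
      push_cast
      ring
    rw [Finset.sum_congr rfl this, Finset.sum_add_distrib, ← Finset.mul_sum, ← Finset.mul_sum,
      ← hQe]
    have h := h d
    rw [hPe] at h
    push_cast
    linear_combination h

/-- weights of `A`, with sign. -/
noncomputable def wA {K : Type*} [Field K] {n m : ℕ} (sg : K) (lam : Fin n → K) (eta : Fin m → K)
    (F : Fin n) (d : ℕ) : K :=
  sg ^ d * ((∏ a : Fin m, ∏ l ∈ Finset.range d, (eta a - lam F - (l : K))) /
      (∏ G : Fin n, ∏ l ∈ Finset.range d, (lam F - lam G + ((l : K) + 1))))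

/-- weights of `B`, with sign. -/
noncomputable def vB {K : Type*} [Field K] {n m : ℕ} (sg : K) (lam : Fin n → K) (eta : Fin m → K)
    (F : Fin n) (d : ℕ) : K :=
  sg ^ d * ((∏ a : Fin m, ∏ l ∈ Finset.range d, (eta a - lam F + ((l : K) + 1))) /
      (∏ G : Fin n, ∏ l ∈ Finset.range d, (lam G - lam F + ((l : K) + 1))))

lemma lam_ne {K : Type*} [Field K] [CharZero K] {n : ℕ} (lam : Fin n → K)
    (hlam : ∀ i j : Fin n, i ≠ j → ∀ z : ℤ, lam i - lam j ≠ (z : K)) (i j : Fin n) (d : ℕ) :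
    lam i - lam j + ((d : K) + 1) ≠ 0 := by
  intro h
  by_cases hij : i = j
  · subst hij
    rw [sub_self, zero_add] at h
    exact Nat.cast_add_one_ne_zero d h
  · apply hlam i j hij (-((d : ℤ) + 1))
    push_cast
    linear_combination h

lemma wA_rec {K : Type*} [Field K] [CharZero K] {n m : ℕ} (sg : K) (lam : Fin n → K)
    (eta : Fin m → K) (hlam : ∀ i j : Fin n, i ≠ j → ∀ z : ℤ, lam i - lam j ≠ (z : K))
    (F : Fin n) (d : ℕ) :
    (∏ G, (Polynomial.X - Polynomial.C (lam G))).eval (lam F + ((d : K) + 1)) *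
      wA sg lam eta F (d + 1) =
    (sg * (-1) ^ m) * (∏ a, (Polynomial.X - Polynomial.C (eta a))).eval (lam F + (d : K)) *
      wA sg lam eta F d := by
  have hP : (∏ G, (Polynomial.X - Polynomial.C (lam G))).eval (lam F + ((d : K) + 1))
      = ∏ G, (lam F - lam G + ((d : K) + 1)) := by
    rw [Polynomial.eval_prod]
    refine Finset.prod_congr rfl fun G _ => ?_
    simp; ring
  have hQ : (-1) ^ m * (∏ a, (Polynomial.X - Polynomial.C (eta a))).eval (lam F + (d : K))
      = ∏ a, (eta a - lam F - (d : K)) := by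
    rw [Polynomial.eval_prod]
    have : (-1 : K) ^ m = ∏ a : Fin m, (-1 : K) := by simp
    rw [this, ← Finset.prod_mul_distrib]
    refine Finset.prod_congr rfl fun G _ => ?_
    simp; ring
  rw [mul_assoc sg, hP, hQ]
  simp only [wA, Finset.prod_range_succ, Finset.prod_mul_distrib]
  have h1 : ∏ G, (lam F - lam G + ((d : K) + 1)) ≠ 0 :=
    Finset.prod_ne_zero_iff.2 fun G _ => lam_ne lam hlam F G d
  have h2 : ∏ G : Fin n, ∏ l ∈ Finset.range d, (lam F - lam G + ((l : K) + 1)) ≠ 0 :=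
    Finset.prod_ne_zero_iff.2 fun G _ => Finset.prod_ne_zero_iff.2 fun l _ =>
      lam_ne lam hlam F G l
  rw [pow_succ]
  field_simp

lemma vB_rec {K : Type*} [Field K] [CharZero K] {n m : ℕ} (sg : K) (lam : Fin n → K)
    (eta : Fin m → K) (hlam : ∀ i j : Fin n, i ≠ j → ∀ z : ℤ, lam i - lam j ≠ (z : K))
    (F : Fin n) (d : ℕ) :
    (∏ G, (Polynomial.X - Polynomial.C (lam G))).eval (lam F - ((d : K) + 1)) *
      vB sg lam eta F (d + 1) =
    (sg * (-1) ^ m * (-1) ^ n) *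
      (∏ a, (Polynomial.X - Polynomial.C (eta a))).eval (lam F - ((d : K) + 1)) *
      vB sg lam eta F d := by
  have hP : (∏ G, (Polynomial.X - Polynomial.C (lam G))).eval (lam F - ((d : K) + 1))
      = (-1) ^ n * ∏ G, (lam G - lam F + ((d : K) + 1)) := by
    rw [Polynomial.eval_prod]
    have : (-1 : K) ^ n = ∏ a : Fin n, (-1 : K) := by simp
    rw [this, ← Finset.prod_mul_distrib]
    refine Finset.prod_congr rfl fun G _ => ?_
    simp; ring
  have hQ : (-1) ^ m * (∏ a, (Polynomial.X - Polynomial.C (eta a))).eval (lam F - ((d : K) + 1))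
      = ∏ a, (eta a - lam F + ((d : K) + 1)) := by
    rw [Polynomial.eval_prod]
    have : (-1 : K) ^ m = ∏ a : Fin m, (-1 : K) := by simp
    rw [this, ← Finset.prod_mul_distrib]
    refine Finset.prod_congr rfl fun G _ => ?_
    simp; ring
  rw [mul_right_comm (sg * (-1) ^ m), mul_assoc sg, hP, hQ]
  simp only [vB, Finset.prod_range_succ, Finset.prod_mul_distrib]
  have h1 : ∏ G, (lam G - lam F + ((d : K) + 1)) ≠ 0 :=
    Finset.prod_ne_zero_iff.2 fun G _ => lam_ne lam hlam G F d
  have h2 : ∏ G : Fin n, ∏ l ∈ Finset.range d, (lam G - lam F + ((l : K) + 1)) ≠ 0 :=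
    Finset.prod_ne_zero_iff.2 fun G _ => Finset.prod_ne_zero_iff.2 fun l _ =>
      lam_ne lam hlam G F l
  rw [pow_succ]
  field_simp

lemma A_det {K : Type*} [Field K] {n r m : ℕ} (lam : Fin n → K) (eta : Fin m → K)
    (hlam : ∀ i j : Fin n, i ≠ j → ∀ z : ℤ, lam i - lam j ≠ (z : K))
    (f : Fin r → Fin n) (hf : Function.Injective f) :
    (Matrix.of fun i j : Fin r =>
      U (lam (f i)) (wA ((-1) ^ (r - 1)) lam eta (f i)) j).det =
    PowerSeries.C (Matrix.vandermonde fun i => lam (f i)).det * Aseries n r m lam eta f := by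
  ext N
  simp only [U]
  rw [coeff_det (fun i d => lam (f i) + (d : K)) (fun i d => wA ((-1) ^ (r - 1)) lam eta (f i) d),
    PowerSeries.coeff_C_mul, Aseries, PowerSeries.coeff_mk, Finset.mul_sum]
  refine Finset.sum_congr rfl fun d _ => ?_
  have h := ratio_prod (fun i => lam (f i)) (fun i j hij => hlam _ _ (hf.ne hij))
    (fun i => (d i : ℤ))
  simp only [Int.natAbs_natCast, Int.cast_natCast] at h
  simp only [wA]
  rw [Finset.prod_mul_distrib, ← mul_assoc, mul_comm (Matrix.det _) (∏ _, _), h]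
  ring

lemma B_det {K : Type*} [Field K] {n r m : ℕ} (lam : Fin n → K) (eta : Fin m → K)
    (hlam : ∀ i j : Fin n, i ≠ j → ∀ z : ℤ, lam i - lam j ≠ (z : K))
    (f : Fin (n - r) → Fin n) (hf : Function.Injective f) :
    (Matrix.of fun i j : Fin (n - r) =>
      V (lam (f i)) (vB ((-1) ^ (n - r - 1)) lam eta (f i)) j).det =
    PowerSeries.C (Matrix.vandermonde fun i => lam (f i)).det * Bseries n r m lam eta f := by
  ext N
  simp only [V]
  rw [coeff_det (fun i d => lam (f i) - (d : K))
      (fun i d => vB ((-1) ^ (n - r - 1)) lam eta (f i) d),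
    PowerSeries.coeff_C_mul, Bseries, PowerSeries.coeff_mk, Finset.mul_sum]
  refine Finset.sum_congr rfl fun d _ => ?_
  have h := ratio_prod (fun i => lam (f i)) (fun i j hij => hlam _ _ (hf.ne hij))
    (fun i => -(d i : ℤ))
  simp only [Int.natAbs_neg, Int.natAbs_natCast, Int.cast_neg, Int.cast_natCast,
    neg_sub_neg, ← sub_eq_add_neg] at h
  simp only [vB]
  rw [Finset.prod_mul_distrib, ← mul_assoc, mul_comm (Matrix.det _) (∏ _, _), h]
  ring

lemma A_zero {K : Type*} [Field K] {n r m : ℕ} (lam : Fin n → K) (eta : Fin m → K)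
    (f : Fin r → Fin n) : PowerSeries.coeff 0 (Aseries n r m lam eta f) = 1 := by
  rw [Aseries, PowerSeries.coeff_mk, Finset.Nat.antidiagonalTuple_zero_right]
  simp [ratioR]

lemma B_zero {K : Type*} [Field K] {n r m : ℕ} (lam : Fin n → K) (eta : Fin m → K)
    (f : Fin (n - r) → Fin n) : PowerSeries.coeff 0 (Bseries n r m lam eta f) = 1 := by
  rw [Bseries, PowerSeries.coeff_mk, Finset.Nat.antidiagonalTuple_zero_right]
  simp [ratioR]

end SB

/-- Seiberg duality for the fundamental building block, case `n = m + 1`: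
`A(q) = exp((-1)^{n-r} q) · B(q)` in `K⟦q⟧`. -/
theorem seiberg_duality_building_block_case2 {K : Type*} [Field K] [CharZero K]
    (n r m : ℕ) (hr : 1 ≤ r) (hrn : r + 1 ≤ n) (hnm : n = m + 1)
    (lam : Fin n → K) (eta : Fin m → K)
    (hlam : ∀ i j : Fin n, i ≠ j → ∀ z : ℤ, lam i - lam j ≠ (z : K))
    (f : Fin r → Fin n) (hf : StrictMono f)
    (f' : Fin (n - r) → Fin n) (hf' : StrictMono f')
    (hcompl : ∀ j : Fin n, (∃ i, f i = j) ↔ ¬ ∃ i, f' i = j) :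
    Aseries n r m lam eta f =
      (PowerSeries.mk fun k => ((-1 : K) ^ (n - r)) ^ k / (Nat.factorial k : K)) *
        Bseries n r m lam eta f' := by
  have hinjl : Function.Injective lam := by
    intro i j h
    by_contra hne
    exact hlam i j hne 0 (by simp [h])
  have hsum : n = r + (n - r) := by omega
  set g : Fin r ⊕ Fin (n - r) → Fin n := Sum.elim f f' with hg
  have hginj : Function.Injective g := by
    refine Function.Injective.sumElim hf.injective hf'.injective ?_
    intro a b h
    exact (hcompl (f a)).1 ⟨a, rfl⟩ ⟨b, h.symm⟩
  have hgbij : Function.Bijective g :=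
    (Fintype.bijective_iff_injective_and_card _).2 ⟨hginj, by simp [← hsum]⟩
  set P : Polynomial K := ∏ G, (Polynomial.X - Polynomial.C (lam G)) with hPdef
  set Q : Polynomial K := ∏ a, (Polynomial.X - Polynomial.C (eta a)) with hQdef
  have hPm : P.Monic := Polynomial.monic_prod_of_monic _ _ fun i _ => Polynomial.monic_X_sub_C _
  have hQm : Q.Monic := Polynomial.monic_prod_of_monic _ _ fun i _ => Polynomial.monic_X_sub_C _
  have hPn : P.natDegree = n := by
    rw [hPdef, Polynomial.natDegree_prod_of_monic _ _ fun i _ => Polynomial.monic_X_sub_C _]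
    simp
  have hQn : Q.natDegree = m := by
    rw [hQdef, Polynomial.natDegree_prod_of_monic _ _ fun i _ => Polynomial.monic_X_sub_C _]
    simp
  have hP0 : ∀ F, P.eval (lam F) = 0 := by
    intro F
    rw [hPdef, Polynomial.eval_prod]
    exact Finset.prod_eq_zero (Finset.mem_univ F) (by simp)
  have hc1 : ((-1 : K) ^ (r - 1)) * (-1) ^ m = (-1) ^ (n - r) := by
    rw [← pow_add, neg_one_pow_eq_pow_mod_two, neg_one_pow_eq_pow_mod_two (n := n - r)]
    congr 1; omega
  have hc2 : ((-1 : K) ^ (n - r - 1)) * (-1) ^ m * (-1) ^ n = (-1) ^ (n - r) := by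
    rw [← pow_add, ← pow_add, neg_one_pow_eq_pow_mod_two, neg_one_pow_eq_pow_mod_two (n := n - r)]
    congr 1; omega
  obtain ⟨W0, k, hW0, hmain⟩ := SB.core hsum (by omega) (fun F => lam (g F))
    (fun i j hij => hlam _ _ (hginj.ne hij))
    (fun F => SB.wA ((-1) ^ (r - 1)) lam eta (g F))
    (fun F => SB.vB ((-1) ^ (n - r - 1)) lam eta (g F))
    (fun F => by simp [SB.wA])
    (fun k => PowerSeries.C (-P.coeff k) +
      PowerSeries.C ((-1) ^ (n - r) * Q.coeff k) * PowerSeries.X) ((-1) ^ (n - r))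
    (fun F => SB.hU_of P Q hPm hPn (by omega) _ _ _ (hP0 _) (fun d => by
      have := SB.wA_rec ((-1) ^ (r - 1)) lam eta hlam (g F) d
      rw [hc1] at this
      exact this))
    (fun F => SB.hY_of P Q hPm hPn (by omega) _ _ _ (hP0 _) (fun d => by
      have := SB.vB_rec ((-1) ^ (n - r - 1)) lam eta hlam (g F) d
      rw [hc2] at this
      exact this))
    (by
      have h1 : P.coeff (n - 1) = -∑ F, lam F := by
        have := Polynomial.prod_X_sub_C_coeff_card_pred (Finset.univ : Finset (Fin n)) lam
          (by simp; omega)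
        simpa [hPdef] using this
      have h2 : Q.coeff (n - 1) = 1 := by
        have : n - 1 = Q.natDegree := by omega
        rw [this]; exact hQm
      rw [h1, h2, neg_neg, mul_one, hgbij.sum_comp lam])
  simp only [hg, Sum.elim_inl, Sum.elim_inr] at hmain
  rw [SB.A_det lam eta hlam f hf.injective, SB.B_det lam eta hlam f' hf'.injective] at hmain
  set d1 := (Matrix.vandermonde fun i => lam (f i)).det
  set d2 := (Matrix.vandermonde fun i => lam (f' i)).det with hd2
  have hd2' : d2 ≠ 0 := by
    rw [hd2, Matrix.det_vandermonde_ne_zero_iff]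
    exact hinjl.comp hf'.injective
  have h0 := congrArg (PowerSeries.constantCoeff (R := K)) hmain
  have hA0 := SB.A_zero lam eta f
  have hB0 := SB.B_zero lam eta f'
  rw [PowerSeries.coeff_zero_eq_constantCoeff] at hA0 hB0
  have hE0 : PowerSeries.constantCoeff (R := K)
      (PowerSeries.mk fun k => ((-1 : K) ^ (n - r)) ^ k / (Nat.factorial k : K)) = 1 := by
    rw [← PowerSeries.coeff_zero_eq_constantCoeff]
    simp
  simp only [map_mul, hA0, hB0, hE0, PowerSeries.constantCoeff_C, mul_one] at h0
  have hne : (PowerSeries.C (W0 * d2) : PowerSeries K) ≠ 0 := by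
    rw [Ne, ← map_zero (PowerSeries.C (R := K)), PowerSeries.C_injective.eq_iff]
    exact mul_ne_zero hW0 hd2'
  apply mul_left_cancel₀ hne
  have h3 : (PowerSeries.C (W0 * d2) : PowerSeries K) = PowerSeries.C d1 * PowerSeries.C k := by
    rw [← map_mul, h0]
  calc _ = PowerSeries.C d1 * Aseries n r m lam eta f * PowerSeries.C k := by rw [h3]; ring
    _ = _ := by rw [hmain, map_mul]; ring
end

section
/- Seiberg duality for the fundamental building block, case n = m (Theorem 5.3(3) / Theorem 1.6(3)): if n = m, then A(q) = P(q) · B(q) in K⟦q⟧, where α := Σ_{A=1}^{m} η_A − Σ_{F=1}^{n} λ_F + (n−r)·1_K ∈ K and P(q) := Σ_{k≥0} (∏_{j=0}^{k−1}(α − j·1_K) / k!) · ((−1)^{n−r})^k q^k is the generalized binomial series (1 + (−1)^{n−r} q)^α. -/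
open Finset

section part1
variable {K : Type*} [Field K]

noncomputable def pcol (m s : ℕ) (z : Fin m → K) : Fin m ⊕ Fin s → Polynomial K :=
  Sum.elim (fun k => ∏ k' ∈ ({k}ᶜ : Finset (Fin m)), (Polynomial.X + Polynomial.C (z k' + 2)))
    (fun j => Polynomial.X ^ (j : ℕ) * ∏ k, (Polynomial.X + Polynomial.C (z k + 2)))

noncomputable def gcol (m s : ℕ) (z : Fin m → K) : Fin m ⊕ Fin s → Polynomial K :=
  Sum.elim (fun j => Polynomial.X ^ (j : ℕ))
    (fun j => Polynomial.X ^ (j : ℕ) * ∏ k, (Polynomial.X + Polynomial.C (z k + 2)))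

noncomputable def ccoef (m : ℕ) (z : Fin m → K) : Matrix (Fin m) (Fin m) K :=
  Matrix.of fun j k => (∏ k' ∈ ({k}ᶜ : Finset (Fin m)),
    (Polynomial.X + Polynomial.C (z k' + 2))).coeff j

lemma prod_monic {m : ℕ} (S : Finset (Fin m)) (z : Fin m → K) :
    (∏ k ∈ S, (Polynomial.X + Polynomial.C (z k + 2))).Monic :=
  Polynomial.monic_prod_of_monic _ _ fun _ _ => Polynomial.monic_X_add_C _

lemma prod_natDegree {m : ℕ} (S : Finset (Fin m)) (z : Fin m → K) :
    (∏ k ∈ S, (Polynomial.X + Polynomial.C (z k + 2))).natDegree = S.card := by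
  rw [Polynomial.natDegree_prod_of_monic _ _ fun _ _ => Polynomial.monic_X_add_C _]
  simp [-map_add]

lemma det_gcol (m s : ℕ) (x : Fin (m + s) → K) (z : Fin m → K) :
    (Matrix.of fun a b : Fin m ⊕ Fin s => (gcol m s z b).eval (x (finSumFinEquiv a))).det
      = (Matrix.vandermonde x).det := by
  rw [Matrix.det_eval_matrixOfPolynomials_eq_det_vandermonde x
    (fun i => gcol m s z (finSumFinEquiv.symm i))]
  · rw [← Matrix.det_submatrix_equiv_self (finSumFinEquiv (m := m) (n := s))]
    congr 1
    ext a b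
    simp
  · intro i
    obtain ⟨a, rfl⟩ := finSumFinEquiv.surjective i
    rw [Equiv.symm_apply_apply]
    rcases a with a | a
    · simp [gcol]
    · simp only [gcol, Sum.elim_inr, finSumFinEquiv_apply_right, Fin.natAdd]
      rw [Polynomial.Monic.natDegree_mul (Polynomial.monic_X_pow _) (prod_monic _ _),
        prod_natDegree]
      simp [add_comm]
  · intro i
    rcases finSumFinEquiv.symm i with a | a
    · exact Polynomial.monic_X_pow _
    · exact (Polynomial.monic_X_pow _).mul (prod_monic _ _)

lemma det_pcol (m s : ℕ) (x : Fin (m + s) → K) (z : Fin m → K) :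
    (Matrix.of fun a b : Fin m ⊕ Fin s => (pcol m s z b).eval (x (finSumFinEquiv a))).det
      = (Matrix.vandermonde x).det * (ccoef m z).det := by
  rw [← det_gcol m s x z]
  have : (Matrix.of fun a b : Fin m ⊕ Fin s => (pcol m s z b).eval (x (finSumFinEquiv a)))
      = (Matrix.of fun a b : Fin m ⊕ Fin s => (gcol m s z b).eval (x (finSumFinEquiv a)))
        * Matrix.fromBlocks (ccoef m z) 0 0 1 := by
    ext a b
    rw [Matrix.mul_apply, Fintype.sum_sum_type]
    rcases b with b | b
    · simp only [pcol, gcol, Matrix.of_apply, Sum.elim_inl, Sum.elim_inr, Matrix.fromBlocks_apply₁₁,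
        Matrix.fromBlocks_apply₂₁, Matrix.zero_apply, mul_zero, sum_const_zero, add_zero, ccoef]
      rw [Polynomial.eval_eq_sum_range' (n := m)]
      · rw [Finset.sum_range]
        refine Finset.sum_congr rfl fun j _ => ?_
        simp [mul_comm]
      · rw [prod_natDegree, card_compl]
        have := b.pos
        simp; omega
    · simp [pcol, gcol, Matrix.one_apply]
  rw [this, Matrix.det_mul, Matrix.det_fromBlocks_zero₂₁]
  simp

lemma det_ccoef (m : ℕ) (z : Fin m → K) :
    (ccoef m z).det = (Matrix.vandermonde z).det := by
  by_cases hz : Function.Injective z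
  · have h := det_pcol m 0 (fun i => - z i - 2) z
    have h2 : (Matrix.vandermonde (fun i => -z i - 2)).det ≠ 0 := by
      rw [Matrix.det_vandermonde_ne_zero_iff]
      intro i j hij
      apply hz
      simpa using hij
    have h3 : (Matrix.of fun a b : Fin m ⊕ Fin 0 =>
        (pcol m 0 z b).eval ((fun i : Fin m => - z i - 2) (finSumFinEquiv a))).det
        = (Matrix.diagonal fun k : Fin m => ∏ k' ∈ ({k}ᶜ : Finset (Fin m)), (z k' - z k)).det := by
      rw [← Matrix.det_submatrix_equiv_self (Equiv.sumEmpty (Fin m) (Fin 0)).symm]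
      congr 1
      ext a b
      simp only [Matrix.submatrix_apply, Matrix.of_apply, Equiv.sumEmpty_symm_apply, pcol,
        Sum.elim_inl, finSumFinEquiv_apply_left]
      rw [Polynomial.eval_prod]
      by_cases hab : a = b
      · subst hab
        rw [Matrix.diagonal_apply_eq]
        refine Finset.prod_congr rfl fun k _ => ?_
        simp
        ring
      · rw [Matrix.diagonal_apply_ne _ hab]
        apply Finset.prod_eq_zero (i := a)
        · simpa using hab
        · simp
    have h4 : (Matrix.vandermonde (fun i => -z i - 2)).det * (Matrix.vandermonde z).det
        = (Matrix.diagonal fun k : Fin m => ∏ k' ∈ ({k}ᶜ : Finset (Fin m)), (z k' - z k)).det := by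
      rw [Matrix.det_diagonal, Matrix.det_vandermonde, Matrix.det_vandermonde,
        ← Finset.prod_prod_Ioi_mul_eq_prod_prod_off_diag (fun i j => z i - z j),
        ← Finset.prod_mul_distrib]
      refine Finset.prod_congr rfl fun i _ => ?_
      rw [← Finset.prod_mul_distrib]
      refine Finset.prod_congr rfl fun j _ => ?_
      ring
    apply mul_left_cancel₀ h2
    rw [h4, ← h3]
    exact h.symm
  · have h1 : (Matrix.vandermonde z).det = 0 := by
      by_contra h
      exact hz (Matrix.det_vandermonde_ne_zero_iff.1 h)
    rw [h1]
    simp only [Function.Injective, not_forall] at hz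
    obtain ⟨a, b, hab, hne⟩ := hz
    apply Matrix.det_zero_of_column_eq hne
    intro j
    simp only [ccoef, Matrix.of_apply]
    congr 1
    have ha : ({a}ᶜ : Finset (Fin m)) = insert b ({a, b}ᶜ) := by
      ext t; simp; grind
    have hb : ({b}ᶜ : Finset (Fin m)) = insert a ({a, b}ᶜ) := by
      ext t; simp; grind
    rw [ha, hb, Finset.prod_insert (by simp), Finset.prod_insert (by simp), hab]

/-- Cauchy-Vandermonde matrix -/
noncomputable def CV (m s : ℕ) (x : Fin (m + s) → K) (z : Fin m → K) :
    Matrix (Fin m ⊕ Fin s) (Fin m ⊕ Fin s) K :=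
  Matrix.of fun a b => Sum.elim (fun k => 1 / (x (finSumFinEquiv a) + z k + 2))
    (fun j : Fin s => x (finSumFinEquiv a) ^ (j : ℕ)) b

lemma det_CV (m s : ℕ) (x : Fin (m + s) → K) (z : Fin m → K)
    (h : ∀ i k, x i + z k + 2 ≠ 0) :
    (CV m s x z).det * ∏ i, ∏ k, (x i + z k + 2)
      = (Matrix.vandermonde x).det * (Matrix.vandermonde z).det := by
  rw [← det_ccoef m z, ← det_pcol, mul_comm]
  rw [← finSumFinEquiv.prod_comp, ← Matrix.det_mul_column]
  congr 1
  ext a b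
  rcases b with b | b
  · simp only [CV, pcol, Matrix.of_apply, Sum.elim_inl]
    rw [Polynomial.eval_prod, ← Finset.prod_mul_prod_compl {b}]
    simp only [Finset.prod_singleton]
    field_simp [h]
    simp [add_assoc]
  · simp [CV, pcol, Polynomial.eval_prod, add_assoc]
    ring


def sh {ι : Type*} [DecidableEq ι] (x : ι → K) (I : Finset ι) : ι → K :=
  fun i => if i ∈ I then x i - 1 else x i

noncomputable def Wt {ι κ : Type*} [Fintype ι] [Fintype κ] [DecidableEq ι]
    (x : ι → K) (z : κ → K) (I : Finset ι) : K :=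
  (∏ i ∈ I, ∏ j ∈ Iᶜ, (x i - 1 - x j) / (x i - x j)) *
    ∏ i ∈ I, ∏ k, (x i + z k + 2) / (x i + z k + 1)

lemma vand_sh {N : ℕ} (x : Fin N → K) (hx : Function.Injective x) (I : Finset (Fin N)) :
    (Matrix.vandermonde (sh x I)).det = (Matrix.vandermonde x).det *
      ∏ i ∈ I, ∏ j ∈ Iᶜ, (x i - 1 - x j) / (x i - x j) := by
  set k : Fin N → Fin N → K := fun j i =>
    if i ∈ I ∧ j ∉ I then (x i - 1 - x j) / (x i - x j) else 1 with hk
  have h1 : ∏ i ∈ I, ∏ j ∈ Iᶜ, (x i - 1 - x j) / (x i - x j) = ∏ i, ∏ j ∈ {i}ᶜ, k j i := by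
    rw [← Finset.prod_subset (Finset.subset_univ I)]
    · refine Finset.prod_congr rfl fun i hi => ?_
      rw [← Finset.prod_subset (s₁ := Iᶜ) (s₂ := {i}ᶜ)]
      · refine Finset.prod_congr rfl fun j hj => ?_
        simp only [hk]
        rw [if_pos ⟨hi, by simpa using hj⟩]
      · intro j hj
        simp at hj ⊢
        rintro rfl
        exact hj hi
      · intro j _ hj
        simp only [hk]
        rw [if_neg]
        simp at hj
        tauto
    · intro i _ hi
      apply Finset.prod_eq_one
      intro j _
      simp [hk, hi]
  rw [h1, ← Finset.prod_prod_Ioi_mul_eq_prod_prod_off_diag, Matrix.det_vandermonde,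
    Matrix.det_vandermonde, ← Finset.prod_mul_distrib]
  refine Finset.prod_congr rfl fun i _ => ?_
  rw [← Finset.prod_mul_distrib]
  refine Finset.prod_congr rfl fun j hj => ?_
  have hij : j ≠ i := ne_of_gt (by simpa using hj)
  have h2 : x j - x i ≠ 0 := sub_ne_zero.2 (fun h => hij (hx h))
  have h3 : x i - x j ≠ 0 := sub_ne_zero.2 (fun h => hij (hx h.symm))
  simp only [hk, sh]
  by_cases hi : i ∈ I <;> by_cases hj : j ∈ I <;> simp [hi, hj]
  · rw [← neg_sub (x i) (x j)]
    field_simp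
    ring
  · field_simp

lemma PP_sh {ι κ : Type*} [Fintype ι] [Fintype κ] [DecidableEq ι]
    (x : ι → K) (z : κ → K) (I : Finset ι) (h1 : ∀ i k, x i + z k + 1 ≠ 0) :
    (∏ i, ∏ k, (sh x I i + z k + 2)) * ∏ i ∈ I, ∏ k, (x i + z k + 2) / (x i + z k + 1)
      = ∏ i, ∏ k, (x i + z k + 2) := by
  rw [← Finset.prod_mul_prod_compl I, ← Finset.prod_mul_prod_compl I
    (fun i => ∏ k, (x i + z k + 2)), mul_right_comm, ← Finset.prod_mul_distrib]
  congr 1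
  · refine Finset.prod_congr rfl fun i hi => ?_
    rw [← Finset.prod_mul_distrib]
    refine Finset.prod_congr rfl fun k _ => ?_
    have := h1 i k
    simp only [sh, if_pos hi]
    field_simp
    ring
  · refine Finset.prod_congr rfl fun i hi => ?_
    simp only [sh, if_neg (Finset.mem_compl.1 hi)]

lemma CV_sh_x (m s : ℕ) (x : Fin (m + s) → K) (z : Fin m → K) (hx : Function.Injective x)
    (h2 : ∀ i k, x i + z k + 2 ≠ 0) (h1 : ∀ i k, x i + z k + 1 ≠ 0) (I : Finset (Fin (m + s))) :
    (CV m s (sh x I) z).det = (CV m s x z).det * Wt x z I := by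
  have h2' : ∀ i k, sh x I i + z k + 2 ≠ 0 := by
    intro i k
    unfold sh
    split_ifs
    · convert h1 i k using 1; ring
    · exact h2 i k
  have hp : ∏ i, ∏ k, (sh x I i + z k + 2) ≠ 0 :=
    Finset.prod_ne_zero_iff.2 fun i _ => Finset.prod_ne_zero_iff.2 fun k _ => h2' i k
  apply mul_right_cancel₀ hp
  rw [det_CV m s _ z h2', vand_sh x hx, Wt, mul_right_comm _ _ (Matrix.det _), ← det_CV m s x z h2,
    ← PP_sh x z I h1]
  ring

lemma CV_sh_z (m s : ℕ) (x : Fin (m + s) → K) (z : Fin m → K) (hz : Function.Injective z)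
    (h2 : ∀ i k, x i + z k + 2 ≠ 0) (h1 : ∀ i k, x i + z k + 1 ≠ 0) (I : Finset (Fin m)) :
    (CV m s x (sh z I)).det = (CV m s x z).det * Wt z x I := by
  have h2' : ∀ i k, x i + sh z I k + 2 ≠ 0 := by
    intro i k
    unfold sh
    split_ifs
    · convert h1 i k using 1; ring
    · exact h2 i k
  have hp : ∏ i, ∏ k, (x i + sh z I k + 2) ≠ 0 :=
    Finset.prod_ne_zero_iff.2 fun i _ => Finset.prod_ne_zero_iff.2 fun k _ => h2' i k
  apply mul_right_cancel₀ hp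
  have hPP := PP_sh z x I (fun i k => by rw [add_comm (z i)]; exact h1 k i)
  rw [det_CV m s x _ h2', vand_sh z hz, Wt, ← mul_assoc, ← det_CV m s x z h2,
    Finset.prod_comm, Finset.prod_comm (f := fun i k => x i + sh z I k + 2)]
  simp_rw [add_comm (x _)]
  rw [← hPP]
  ring

/-- the mixed determinant -/
noncomputable def MX (m s : ℕ) (x : Fin (m + s) → K) (z : Fin m → K) (q : K) :
    Matrix (Fin m ⊕ Fin s) (Fin m ⊕ Fin s) K :=
  CV m s x z + q • CV m s (fun i => x i - 1) z

noncomputable def MZ (m s : ℕ) (x : Fin (m + s) → K) (z : Fin m → K) (q : K) :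
    Matrix (Fin m ⊕ Fin s) (Fin m ⊕ Fin s) K :=
  Matrix.of fun a b => Sum.elim (fun k => 1 / (x (finSumFinEquiv a) + z k + 2)
      + q * (1 / (x (finSumFinEquiv a) + (z k - 1) + 2)))
    (fun j : Fin s => x (finSumFinEquiv a) ^ (j : ℕ)) b

lemma det_MX (m s : ℕ) (x : Fin (m + s) → K) (z : Fin m → K) (q : K) :
    (MX m s x z q).det = ∑ I : Finset (Fin (m + s)), q ^ #I * (CV m s (sh x I) z).det := by
  have : (MX m s x z q).det = Matrix.detRowAlternating.toMultilinearMap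
    ((fun a => q • CV m s (fun i => x i - 1) z a) + fun a => CV m s x z a) := by
    rw [add_comm]; rfl
  rw [this, MultilinearMap.map_add_univ]
  rw [← (Equiv.finsetCongr (finSumFinEquiv (m := m) (n := s))).sum_comp]
  refine Finset.sum_congr rfl fun I _ => ?_
  have h := MultilinearMap.map_piecewise_smul (Matrix.detRowAlternating.toMultilinearMap)
    (fun _ => q) (fun a => CV m s (sh x (Equiv.finsetCongr finSumFinEquiv I)) z a) I
  simp only [prod_const] at h
  have h3 : ((I.piecewise (fun a ↦ q • CV m s (fun i ↦ x i - 1) z a) fun a ↦ CV m s x z a) :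
      Fin m ⊕ Fin s → Fin m ⊕ Fin s → K) = I.piecewise (fun i =>
        q • CV m s (sh x (Equiv.finsetCongr finSumFinEquiv I)) z i)
        (fun a => CV m s (sh x (Equiv.finsetCongr finSumFinEquiv I)) z a) := by
    ext a b
    by_cases ha : a ∈ I <;> simp [ha, CV, sh]
  rw [h3, h]
  rw [smul_eq_mul]
  congr 2
  simp

lemma det_MZ (m s : ℕ) (x : Fin (m + s) → K) (z : Fin m → K) (q : K) :
    (MZ m s x z q).det = ∑ I : Finset (Fin m), q ^ #I * (CV m s x (sh z I)).det := by
  set t : Finset (Fin m ⊕ Fin s) := univ.map Function.Embedding.inl with ht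
  set u : Matrix (Fin m ⊕ Fin s) (Fin m ⊕ Fin s) K := (CV m s x z).transpose with hu
  set v : Matrix (Fin m ⊕ Fin s) (Fin m ⊕ Fin s) K :=
    (CV m s x (fun k => z k - 1)).transpose with hv
  have : (MZ m s x z q).det = Matrix.detRowAlternating.toMultilinearMap
    (t.piecewise ((fun a => q • v a) + fun a => u a) (fun a => u a)) := by
    have hmat : (MZ m s x z q).transpose =
        t.piecewise ((fun a => q • v a) + fun a => u a) (fun a => u a) := by
      ext a b
      rcases a with a | a
      · have : (Sum.inl a : Fin m ⊕ Fin s) ∈ t := by simp [ht]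
        simp [MZ, this, hu, hv, CV]
        exact add_comm (_ : K) _
      · have : (Sum.inr a : Fin m ⊕ Fin s) ∉ t := by simp [ht]
        simp [MZ, this, hu, CV]
    rw [← Matrix.det_transpose, hmat]
    rfl
  rw [this, MultilinearMap.map_piecewise_add]
  symm
  refine Finset.sum_bij (fun I _ => I.map Function.Embedding.inl) ?_ ?_ ?_ ?_
  · intro I _
    simp [ht, Finset.map_subset_map]
  · intro I _ J _ h
    exact Finset.map_injective _ h
  · intro J hJ
    rw [Finset.mem_powerset, ht, Finset.subset_map_iff] at hJ
    obtain ⟨I, _, rfl⟩ := hJ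
    exact ⟨I, Finset.mem_univ _, rfl⟩
  intro I _
  have h := MultilinearMap.map_piecewise_smul (Matrix.detRowAlternating.toMultilinearMap)
    (fun _ => q) (fun a => (CV m s x (sh z I)).transpose a) (I.map Function.Embedding.inl)
  simp only [prod_const] at h
  have h3 : (((I.map Function.Embedding.inl).piecewise (fun a ↦ q • v a) fun a ↦ u a) :
      Fin m ⊕ Fin s → Fin m ⊕ Fin s → K) = (I.map Function.Embedding.inl).piecewise (fun i =>
        q • (CV m s x (sh z I)).transpose i)
        (fun a => (CV m s x (sh z I)).transpose a) := by
    ext a b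
    rcases a with a | a
    · by_cases ha : a ∈ I <;> simp [ha, CV, sh, hu, hv, Finset.piecewise]
    · simp [CV, hu, Finset.piecewise]
  rw [h3, h, smul_eq_mul, Finset.card_map, ← Matrix.det_transpose]
  rfl

lemma det_MX_MZ (m s : ℕ) (x : Fin (m + s) → K) (z : Fin m → K) (q : K) :
    (MX m s x z q).det = (MZ m s x z q).det * (1 + q) ^ s := by
  set U : Matrix (Fin s) (Fin s) K := Matrix.of fun i j =>
    (if i = j then 1 else 0) + q * ((-1) ^ ((j : ℕ) - (i : ℕ)) * ((j : ℕ).choose i)) with hU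
  have h : MX m s x z q = MZ m s x z q * Matrix.fromBlocks 1 0 0 U := by
    ext a b
    rw [Matrix.mul_apply, Fintype.sum_sum_type]
    rcases b with b | b
    · simp [MX, MZ, CV, Matrix.one_apply]
      left
      ring_nf
    · simp [MX, MZ, CV, hU, mul_add, Finset.sum_add_distrib]
      generalize x (finSumFinEquiv a) = y
      rw [sub_eq_add_neg, add_pow, Finset.mul_sum,
        Fin.sum_univ_eq_sum_range (fun i => y ^ i * (q * ((-1) ^ ((b : ℕ) - i) * ((b : ℕ).choose i : K)))) s]
      rw [← Finset.sum_subset (s₁ := Finset.range (b + 1)) (s₂ := Finset.range s)]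
      · refine Finset.sum_congr rfl fun i _ => ?_
        ring
      · intro i; simp; omega
      · intro i _ hi
        simp at hi
        rw [Nat.choose_eq_zero_of_lt (by omega)]
        simp
  have hdet : U.det = (1 + q) ^ s := by
    rw [Matrix.det_of_isUpperTriangular]
    · simp [hU]
    · intro i j hij
      simp only [id] at hij
      simp [hU, hij.ne', Nat.choose_eq_zero_of_lt hij]
  rw [h, Matrix.det_mul, Matrix.det_fromBlocks_zero₂₁, hdet]
  simp


lemma generic_fin (m s : ℕ) (x : Fin (m + s) → K) (z : Fin m → K) (hx : Function.Injective x)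
    (hz : Function.Injective z)
    (h2 : ∀ i k, x i + z k + 2 ≠ 0) (h1 : ∀ i k, x i + z k + 1 ≠ 0) (q : K) :
    ∑ I : Finset (Fin (m + s)), q ^ #I * Wt x z I
      = (∑ J : Finset (Fin m), q ^ #J * Wt z x J) * (1 + q) ^ s := by
  have h0 : (CV m s x z).det ≠ 0 := by
    intro h
    have := det_CV m s x z h2
    rw [h, zero_mul] at this
    exact mul_ne_zero (Matrix.det_vandermonde_ne_zero_iff.2 hx)
      (Matrix.det_vandermonde_ne_zero_iff.2 hz) this.symm
  have h := det_MX_MZ m s x z q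
  rw [det_MX, det_MZ] at h
  simp_rw [CV_sh_x m s x z hx h2 h1, CV_sh_z m s x z hz h2 h1] at h
  apply mul_left_cancel₀ h0
  rw [← mul_assoc, Finset.mul_sum, Finset.mul_sum]
  simp_rw [mul_left_comm (Matrix.det _)]
  exact h

lemma Wt_equiv {ι κ ι' κ' : Type*} [Fintype ι] [Fintype κ] [DecidableEq ι]
    [Fintype ι'] [Fintype κ'] [DecidableEq ι'] (e : ι' ≃ ι) (e' : κ' ≃ κ)
    (x : ι → K) (z : κ → K) (I : Finset ι') :
    Wt x z (e.finsetCongr I) = Wt (x ∘ e) (z ∘ e') I := by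
  have hc : (I.map e.toEmbedding)ᶜ = Iᶜ.map e.toEmbedding := by
    ext a
    obtain ⟨b, rfl⟩ := e.surjective a
    simp
  simp only [Wt, Equiv.finsetCongr_apply, hc, Finset.prod_map]
  simp_rw [← e'.prod_comp]
  rfl

lemma generic_q {ι κ : Type*} [Fintype ι] [Fintype κ] [DecidableEq ι] [DecidableEq κ] (s : ℕ)
    (hs : Fintype.card ι = Fintype.card κ + s) (x : ι → K) (z : κ → K)
    (hx : Function.Injective x) (hz : Function.Injective z)
    (h2 : ∀ i k, x i + z k + 2 ≠ 0) (h1 : ∀ i k, x i + z k + 1 ≠ 0) (q : K) :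
    ∑ I : Finset ι, q ^ #I * Wt x z I = (∑ J : Finset κ, q ^ #J * Wt z x J) * (1 + q) ^ s := by
  let e : Fin (Fintype.card κ + s) ≃ ι := (Fintype.equivFinOfCardEq hs).symm
  let e' : Fin (Fintype.card κ) ≃ κ := (Fintype.equivFin κ).symm
  have h := generic_fin _ s (x ∘ e) (z ∘ e') (hx.comp e.injective) (hz.comp e'.injective)
    (fun _ _ => h2 _ _) (fun _ _ => h1 _ _) q
  rw [← e.finsetCongr.sum_comp, ← e'.finsetCongr.sum_comp]
  simp_rw [Wt_equiv e e', Wt_equiv e' e]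
  simpa using h

noncomputable def cW {ι κ : Type*} [Fintype ι] [Fintype κ] [DecidableEq ι]
    (x : ι → K) (z : κ → K) (N : ℕ) : K :=
  ∑ I : Finset ι with #I = N, Wt x z I

lemma generic_coeff [CharZero K] {ι κ : Type*} [Fintype ι] [Fintype κ] [DecidableEq ι]
    [DecidableEq κ] (s : ℕ)
    (hs : Fintype.card ι = Fintype.card κ + s) (x : ι → K) (z : κ → K)
    (hx : Function.Injective x) (hz : Function.Injective z)
    (h2 : ∀ i k, x i + z k + 2 ≠ 0) (h1 : ∀ i k, x i + z k + 1 ≠ 0) (N : ℕ) :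
    cW x z N = ∑ p ∈ antidiagonal N, (s.choose p.1 : K) * cW z x p.2 := by
  have h : (∑ I : Finset ι, Polynomial.C (Wt x z I) * Polynomial.X ^ #I)
      = (1 + Polynomial.X) ^ s *
        (∑ J : Finset κ, Polynomial.C (Wt z x J) * Polynomial.X ^ #J) := by
    apply Polynomial.funext
    intro q
    have := generic_q s hs x z hx hz h2 h1 q
    simp only [Polynomial.eval_finsetSum, Polynomial.eval_mul, Polynomial.eval_C,
      Polynomial.eval_pow, Polynomial.eval_X, Polynomial.eval_add, Polynomial.eval_one]
    rw [mul_comm]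
    simp_rw [mul_comm (Wt _ _ _)]
    exact this
  have h3 := congrArg (fun p => Polynomial.coeff p N) h
  beta_reduce at h3
  rw [Polynomial.coeff_mul] at h3
  simp only [Polynomial.finsetSum_coeff, Polynomial.coeff_one_add_X_pow,
    Polynomial.coeff_C_mul_X_pow] at h3
  simp only [cW, Finset.sum_filter]
  simp only [eq_comm (a := #_)]
  exact h3

end part1
section part4
variable {K : Type*} [Field K]

lemma ratioR_mul [CharZero K] (x : K) (a b : ℕ) (hx : (x = 0 ∧ a = b) ∨ ∀ z : ℤ, x ≠ z) :
    ratioR x ((a : ℤ) - b) * ∏ l ∈ range b, (x + a - l) = ∏ l ∈ range a, (x + ((l : K) + 1)) := by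
  rcases le_total b a with h | h
  · obtain ⟨c, rfl⟩ := Nat.exists_eq_add_of_le h
    have h1 : ((b + c : ℕ) : ℤ) - b = c := by push_cast; ring
    rw [h1, ratioR, if_pos (by positivity), Int.toNat_natCast, add_comm b c, Finset.prod_range_add]
    congr 1
    rw [← Finset.prod_range_reflect]
    refine Finset.prod_congr rfl fun l hl => ?_
    rw [Finset.mem_range] at hl
    have : ((b - 1 - l : ℕ) : K) = b - 1 - l := by
      rw [Nat.cast_sub (by omega), Nat.cast_sub (by omega)]; simp
    rw [this]
    push_cast
    ring
  · rcases hx with ⟨rfl, rfl⟩ | hx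
    · simp only [sub_self, ratioR]
      simp
      rw [← Finset.prod_range_reflect]
      refine Finset.prod_congr rfl fun l hl => ?_
      rw [Finset.mem_range] at hl
      have : ((a - 1 - l : ℕ) : K) = a - 1 - l := by
        rw [Nat.cast_sub (by omega), Nat.cast_sub (by omega)]; simp
      rw [this]
      ring
    obtain ⟨c, rfl⟩ := Nat.exists_eq_add_of_le h
    have h1 : (a : ℤ) - (a + c : ℕ) = -c := by push_cast; ring
    have hne : ∏ l ∈ range c, (x - (l : K)) ≠ 0 := by
      refine Finset.prod_ne_zero_iff.2 fun l _ hl => hx l ?_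
      rw [sub_eq_zero] at hl
      simpa using hl
    have h2 : ratioR x (-(c : ℤ)) = (∏ l ∈ range c, (x - (l : K)))⁻¹ := by
      unfold ratioR
      split_ifs with h
      · have : c = 0 := by omega
        subst this
        simp
      · simp
    rw [h1, h2, Finset.prod_range_add]
    have h3 : ∏ l ∈ range c, (x + a - ((a + l : ℕ) : K)) = ∏ l ∈ range c, (x - (l : K)) := by
      refine Finset.prod_congr rfl fun l hl => ?_
      push_cast
      ring
    rw [h3, mul_comm, mul_assoc, mul_inv_cancel₀ hne, mul_one, ← Finset.prod_range_reflect]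
    refine Finset.prod_congr rfl fun l hl => ?_
    rw [Finset.mem_range] at hl
    have : ((a - 1 - l : ℕ) : K) = a - 1 - l := by
      rw [Nat.cast_sub (by omega), Nat.cast_sub (by omega)]; simp
    rw [this]
    ring

def LowS {r : ℕ} (α : Fin r → ℕ) (d : Fin r → ℕ) : Finset (Σ i : Fin r, Fin (α i)) :=
  univ.filter fun s => (s.2 : ℕ) < d s.1

lemma prod_LowS {r : ℕ} (α d : Fin r → ℕ) (h : ∀ i, d i ≤ α i) (g : Fin r → ℕ → K) :
    ∏ s ∈ LowS α d, g s.1 s.2 = ∏ i, ∏ l ∈ range (d i), g i l := by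
  rw [LowS, Finset.prod_filter, Fintype.prod_sigma]
  refine Finset.prod_congr rfl fun i _ => ?_
  dsimp only
  rw [Fin.prod_univ_eq_prod_range (fun l => if l < d i then g i l else 1) (α i),
    ← Finset.prod_filter]
  refine Finset.prod_congr ?_ fun _ _ => rfl
  ext l
  have := h i
  simp
  omega

lemma prod_LowS_compl {r : ℕ} (α d : Fin r → ℕ) (g : Fin r → ℕ → K) :
    ∏ s ∈ (LowS α d)ᶜ, g s.1 s.2 = ∏ i, ∏ l ∈ Ico (d i) (α i), g i l := by
  rw [LowS, Finset.compl_filter, Finset.prod_filter, Fintype.prod_sigma]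
  refine Finset.prod_congr rfl fun i _ => ?_
  dsimp only
  rw [Fin.prod_univ_eq_prod_range (fun l => if ¬ l < d i then g i l else 1) (α i),
    ← Finset.prod_filter]
  refine Finset.prod_congr ?_ fun _ _ => rfl
  ext l
  simp
  omega

lemma card_LowS {r : ℕ} (α d : Fin r → ℕ) (h : ∀ i, d i ≤ α i) : #(LowS α d) = ∑ i, d i := by
  have : LowS α d = univ.sigma (fun i => univ.filter fun l : Fin (α i) => (l : ℕ) < d i) := by
    ext ⟨i, l⟩; simp [LowS]
  rw [this, Finset.card_sigma]
  refine Finset.sum_congr rfl fun i _ => ?_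
  rw [Fin.card_filter_val_lt]
  simp [h i]

lemma telescope1 (c : K) (B : ℕ) (h : ∀ l : ℕ, c + l + 1 ≠ 0) :
    ∏ l ∈ range B, (c + l + 2) / (c + l + 1) = (c + B + 1) / (c + 1) := by
  induction B with
  | zero => simp; rw [div_self]; simpa using h 0
  | succ B ih =>
    rw [Finset.prod_range_succ, ih]
    have h1 := h 0
    have h2 := h B
    simp only [Nat.cast_zero, add_zero] at h1
    push_cast
    field_simp
    ring

lemma telescope2 (c : K) (D A : ℕ) (hDA : D ≤ A) (h : ∀ l : ℕ, D ≤ l → c - l ≠ 0) :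
    ∏ l ∈ Ico D A, (c - 1 - l) / (c - l) = (c - A) / (c - D) := by
  induction A, hDA using Nat.le_induction with
  | base => simp; rw [div_self]; exact h D le_rfl
  | succ A hA ih =>
    rw [Finset.prod_Ico_succ_top hA, ih]
    have h1 := h D le_rfl
    have h2 := h A hA
    push_cast
    field_simp
    ring

noncomputable def str {r : ℕ} (a : Fin r → K) (α : Fin r → ℕ) (s : Σ i : Fin r, Fin (α i)) : K :=
  a s.1 + ((s.2 : ℕ) : K)

noncomputable def wd {r p : ℕ} (a : Fin r → K) (b : Fin p → K) (α : Fin r → ℕ) (β : Fin p → ℕ)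
    (d : Fin r → ℕ) : K :=
  (∏ I : Fin r, ∏ J ∈ Finset.univ.filter (fun J => J ≠ I),
        ratioR (a I - a J) ((d I : ℤ) - (d J : ℤ))) *
    ∏ I : Fin r,
      ((∏ j, ∏ l ∈ range (d I), (a j + α j - a I - (l : K))) *
        ∏ k, ∏ l ∈ range (d I), (a I + b k + l + β k + 1)) /
      ((∏ j, ∏ l ∈ range (d I), (a I - a j + ((l : K) + 1))) *
        ∏ k, ∏ l ∈ range (d I), (a I + b k + l + 1))

lemma wd_eq_zero {r p : ℕ} (a : Fin r → K) (b : Fin p → K) (α : Fin r → ℕ) (β : Fin p → ℕ)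
    (d : Fin r → ℕ) (h : ¬ ∀ i, d i ≤ α i) : wd a b α β d = 0 := by
  push Not at h
  obtain ⟨i, hi⟩ := h
  unfold wd
  refine mul_eq_zero_of_right _ (Finset.prod_eq_zero (Finset.mem_univ i) ?_)
  rw [Finset.prod_eq_zero (Finset.mem_univ i), zero_mul, zero_div]
  exact Finset.prod_eq_zero (Finset.mem_range.2 hi) (by ring)

lemma Wt_LowS [CharZero K] {r p : ℕ} (a : Fin r → K) (b : Fin p → K) (α : Fin r → ℕ) (β : Fin p → ℕ)
    (ha : ∀ i j, i ≠ j → ∀ z : ℤ, a i - a j ≠ z) (hab : ∀ i k, ∀ z : ℤ, a i + b k ≠ z)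
    (d : Fin r → ℕ) (h : ∀ i, d i ≤ α i) :
    Wt (str a α) (str b β) (LowS α d) = wd a b α β d := by
  have hz : ∀ i k (l l' : ℕ), a i + b k + l + l' + 1 ≠ 0 := by
    intro i k l l' h
    apply hab i k (-l - l' - 1)
    push_cast
    linear_combination h
  have hR : ∀ i j, ratioR (a i - a j) ((d i : ℤ) - d j) * ∏ l ∈ range (d j), (a i - a j + d i - l)
      = ∏ l ∈ range (d i), (a i - a j + ((l : K) + 1)) := by
    intro i j
    apply ratioR_mul
    by_cases hij : i = j
    · left; simp [hij]
    · right; exact ha i j hij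
  have hDn : ∀ i j, ∏ l ∈ range (d i), (a i - a j + ((l : K) + 1)) ≠ 0 := by
    intro i j
    refine Finset.prod_ne_zero_iff.2 fun l _ hl => ?_
    by_cases hij : i = j
    · rw [hij, sub_self, zero_add] at hl
      exact Nat.cast_add_one_ne_zero l hl
    · apply ha i j hij (-l - 1)
      push_cast
      linear_combination hl
  have hR0 : ∀ i j, ratioR (a i - a j) ((d i : ℤ) - d j) ≠ 0 := by
    intro i j h
    apply hDn i j
    rw [← hR, h, zero_mul]
  have hRp : (∏ I : Fin r, ∏ J ∈ Finset.univ.filter (fun J => J ≠ I),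
        ratioR (a I - a J) ((d I : ℤ) - (d J : ℤ))) = ∏ I : Fin r, ∏ J,
        ratioR (a I - a J) ((d I : ℤ) - (d J : ℤ)) := by
    refine Finset.prod_congr rfl fun i _ => ?_
    rw [Finset.prod_filter]
    refine Finset.prod_congr rfl fun j _ => ?_
    split_ifs with hij
    · rfl
    · push Not at hij
      subst hij
      simp [ratioR]
  -- z part
  have hzp : ∏ s ∈ LowS α d, ∏ k, (str a α s + str b β k + 2) / (str a α s + str b β k + 1)
      = ∏ i, (∏ k, ∏ l ∈ range (d i), (a i + b k + l + β k + 1)) /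
        (∏ k, ∏ l ∈ range (d i), (a i + b k + l + 1)) := by
    have e1 := prod_LowS α d h (fun i l => ∏ t, (a i + l + str b β t + 2) / (a i + l + str b β t + 1))
    refine e1.trans ?_
    refine Finset.prod_congr rfl fun i _ => ?_
    simp_rw [← Finset.prod_div_distrib]
    rw [Finset.prod_comm (s := univ)]
    refine Finset.prod_congr rfl fun l hl => ?_
    rw [Fintype.prod_sigma]
    refine Finset.prod_congr rfl fun k _ => ?_
    have e3 := telescope1 (a i + b k + l) (β k) (fun l' => hz i k l l')
    rw [← e3, ← Fin.prod_univ_eq_prod_range (fun l' => (a i + b k + l + (l' : K) + 2) /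
      (a i + b k + l + (l' : K) + 1))]
    refine Finset.prod_congr rfl fun l' _ => ?_
    simp only [str]
    congr 1 <;> ring
  have hxp : ∏ s ∈ LowS α d, ∏ j ∈ (LowS α d)ᶜ,
      (str a α s - 1 - str a α j) / (str a α s - str a α j)
      = ∏ i, ∏ j, ∏ l ∈ range (d i), (a j + α j - a i - (l : K)) / (a j - a i + d j - l) := by
    have e1 := prod_LowS α d h (fun i l => ∏ j ∈ (LowS α d)ᶜ,
      (a i + l - 1 - str a α j) / (a i + l - str a α j))
    refine e1.trans ?_
    refine Finset.prod_congr rfl fun i _ => ?_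
    rw [Finset.prod_comm (s := univ)]
    refine Finset.prod_congr rfl fun l hl => ?_
    have e2 := prod_LowS_compl α d (fun j l' =>
      (a i + l - 1 - (a j + (l' : K))) / (a i + l - (a j + (l' : K))))
    refine e2.trans ?_
    refine Finset.prod_congr rfl fun j _ => ?_
    have hne : ∀ l' : ℕ, d j ≤ l' → a i - a j + l - l' ≠ 0 := by
      intro l' hl' h0
      by_cases hij : i = j
      · subst hij
        rw [sub_self, zero_add, sub_eq_zero, Nat.cast_inj] at h0
        rw [Finset.mem_range] at hl
        omega
      · apply ha i j hij (l' - l)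
        push_cast
        linear_combination h0
    have e3 := telescope2 (a i - a j + l) (d j) (α j) (h j) hne
    have e4 : (a j + α j - a i - (l : K)) / (a j - a i + d j - l)
        = (a i - a j + l - α j) / (a i - a j + l - d j) := by
      rw [← neg_div_neg_eq]
      congr 1 <;> ring
    rw [e4, ← e3]
    refine Finset.prod_congr rfl fun l' _ => ?_
    congr 1 <;> ring
  rw [Wt, hzp, hxp, wd, hRp]
  simp_rw [mul_div_mul_comm]
  rw [Finset.prod_mul_distrib, ← mul_assoc]
  congr 1
  simp_rw [Finset.prod_div_distrib]
  rw [mul_div_assoc', eq_div_iff, div_mul_eq_mul_div, div_eq_iff]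
  · simp_rw [← hR, Finset.prod_mul_distrib]
    rw [Finset.prod_comm (f := fun i j => ∏ l ∈ range (d j), (a i - a j + d i - l))]
    ring
  · refine Finset.prod_ne_zero_iff.2 fun i _ => Finset.prod_ne_zero_iff.2 fun j _ => ?_
    intro h0
    apply hDn j i
    rw [← hR, h0, mul_zero]
  · exact Finset.prod_ne_zero_iff.2 fun i _ => Finset.prod_ne_zero_iff.2 fun j _ => hDn i j

lemma Wt_ne_zero {r p : ℕ} (a : Fin r → K) (b : Fin p → K) (α : Fin r → ℕ) (β : Fin p → ℕ)
    (I : Finset (Σ i : Fin r, Fin (α i)))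
    (h : Wt (str a α) (str b β) I ≠ 0) : ∃ d : Fin r → ℕ, (∀ i, d i ≤ α i) ∧ LowS α d = I := by
  classical
  let P : Fin r → ℕ → Prop := fun i l => ∃ h : l < α i, (⟨i, ⟨l, h⟩⟩ : Σ i : Fin r, Fin (α i)) ∈ I
  have hstep : ∀ i l, P i (l + 1) → P i l := by
    rintro i l ⟨h1, h2⟩
    refine ⟨by omega, ?_⟩
    by_contra h3
    apply h
    unfold Wt
    apply mul_eq_zero_of_left
    apply Finset.prod_eq_zero h2
    apply Finset.prod_eq_zero (Finset.mem_compl.2 h3)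
    simp [str]
    ring
  have hdown : ∀ i l l', l ≤ l' → P i l' → P i l := by
    intro i l l' hl
    induction l', hl using Nat.le_induction with
    | base => exact id
    | succ n _ ih => exact fun hh => ih (hstep i n hh)
  have hex : ∀ i, ∃ l, ¬ P i l := fun i => ⟨α i, fun ⟨h, _⟩ => lt_irrefl _ h⟩
  refine ⟨fun i => Nat.find (hex i), ?_, ?_⟩
  · intro i
    exact Nat.find_min' (hex i) fun ⟨h, _⟩ => lt_irrefl _ h
  · ext ⟨i, l⟩
    simp only [LowS, mem_filter, mem_univ, true_and]
    constructor
    · intro hl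
      have := Nat.find_min (hex i) hl
      rw [not_not] at this
      exact this.2
    · intro hl
      by_contra hlt
      push Not at hlt
      exact Nat.find_spec (hex i) (hdown i _ _ hlt ⟨l.2, hl⟩)

lemma cW_str [CharZero K] {r p : ℕ} (a : Fin r → K) (b : Fin p → K) (α : Fin r → ℕ) (β : Fin p → ℕ)
    (ha : ∀ i j, i ≠ j → ∀ z : ℤ, a i - a j ≠ z) (hab : ∀ i k, ∀ z : ℤ, a i + b k ≠ z) (N : ℕ) :
    cW (str a α) (str b β) N = ∑ d ∈ Finset.Nat.antidiagonalTuple r N, wd a b α β d := by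
  classical
  rw [← Finset.sum_subset (Finset.filter_subset (fun d => ∀ i, d i ≤ α i) _)]
  · symm
    unfold cW
    apply Finset.sum_of_injOn (LowS α)
    · intro d hd d' hd' hdd
      simp only [coe_filter, Set.mem_ofPred_eq] at hd hd'
      have key : ∀ d d' : Fin r → ℕ, (∀ i, d' i ≤ α i) → LowS α d = LowS α d' →
          ∀ i, d' i ≤ d i := by
        intro d d' h' he i
        by_contra hlt
        push Not at hlt
        have h1 : (⟨i, ⟨d i, hlt.trans_le (h' i)⟩⟩ : Σ i : Fin r, Fin (α i)) ∈ LowS α d' := by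
          simpa [LowS] using hlt
        rw [← he] at h1
        simp [LowS] at h1
      funext i
      exact le_antisymm (key d' d hd.2 hdd.symm i) (key d d' hd'.2 hdd i)
    · intro d hd
      simp only [coe_filter, Set.mem_ofPred_eq, Finset.Nat.mem_antidiagonalTuple] at hd
      simp [card_LowS α d hd.2, hd.1]
    · intro I hI hI2
      by_contra h0
      obtain ⟨d, hd, rfl⟩ := Wt_ne_zero a b α β I h0
      apply hI2
      refine ⟨d, ?_, rfl⟩
      simp only [mem_filter, mem_univ, true_and] at hI
      simp only [coe_filter, Set.mem_ofPred_eq, Finset.Nat.mem_antidiagonalTuple]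
      rw [card_LowS α d hd] at hI
      exact ⟨hI, hd⟩
    · intro d hd
      simp only [mem_filter] at hd
      exact (Wt_LowS a b α β ha hab d hd.2).symm
  · intro d hd hd2
    apply wd_eq_zero
    intro h
    exact hd2 (by simp only [mem_filter]; exact ⟨hd, h⟩)

lemma str_inj [CharZero K] {r : ℕ} (a : Fin r → K) (α : Fin r → ℕ)
    (ha : ∀ i j, i ≠ j → ∀ z : ℤ, a i - a j ≠ z) : Function.Injective (str a α) := by
  rintro ⟨i, l⟩ ⟨j, l'⟩ h
  simp only [str] at h
  by_cases hij : i = j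
  · subst hij
    simp only [add_right_inj, Nat.cast_inj] at h
    rw [Fin.ext h]
  · exfalso
    apply ha i j hij ((l' : ℕ) - (l : ℕ) : ℤ)
    push_cast
    linear_combination h

lemma special [CharZero K] {r p : ℕ} (a : Fin r → K) (b : Fin p → K) (α : Fin r → ℕ)
    (β : Fin p → ℕ) (s : ℕ) (hs : ∑ i, α i = ∑ k, β k + s)
    (ha : ∀ i j, i ≠ j → ∀ z : ℤ, a i - a j ≠ z) (hb : ∀ i j, i ≠ j → ∀ z : ℤ, b i - b j ≠ z)
    (hab : ∀ i k, ∀ z : ℤ, a i + b k ≠ z) (N : ℕ) :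
    ∑ d ∈ Finset.Nat.antidiagonalTuple r N, wd a b α β d =
      ∑ t ∈ antidiagonal N, (s.choose t.1 : K) *
        ∑ d ∈ Finset.Nat.antidiagonalTuple p t.2, wd b a β α d := by
  rw [← cW_str a b α β ha hab]
  simp_rw [← cW_str b a β α hb (fun i k z => by rw [add_comm]; exact hab k i z)]
  apply generic_coeff s _ _ _ (str_inj a α ha) (str_inj b β hb)
  · rintro ⟨i, l⟩ ⟨k, l'⟩ h
    apply hab i k (-(l : ℕ) - (l' : ℕ) - 2)
    simp only [str] at h
    push_cast
    linear_combination h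
  · rintro ⟨i, l⟩ ⟨k, l'⟩ h
    apply hab i k (-(l : ℕ) - (l' : ℕ) - 1)
    simp only [str] at h
    push_cast
    linear_combination h
  · simpa using hs

end part4

section part5
variable {K : Type*} [Field K]

noncomputable def eqv (n r : ℕ) (f : Fin r → Fin n) (hf : StrictMono f)
    (f' : Fin (n - r) → Fin n) (hf' : StrictMono f')
    (hcompl : ∀ j : Fin n, (∃ i, f i = j) ↔ ¬ ∃ i, f' i = j) :
    Fin r ⊕ Fin (n - r) ≃ Fin n :=
  Equiv.ofBijective (Sum.elim f f') <| by
    constructor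
    · refine hf.injective.sumElim hf'.injective ?_
      intro i k h
      exact (hcompl (f i)).1 ⟨i, rfl⟩ ⟨k, h.symm⟩
    · intro j
      by_cases h : ∃ i, f' i = j
      · obtain ⟨i, hi⟩ := h
        exact ⟨Sum.inr i, hi⟩
      · obtain ⟨i, hi⟩ := (hcompl j).2 h
        exact ⟨Sum.inl i, hi⟩

lemma prod_neg_pow {ι : Type*} (S : Finset ι) (g h : ι → K) (hgh : ∀ i ∈ S, g i = - h i) :
    ∏ i ∈ S, g i = (-1) ^ #S * ∏ i ∈ S, h i := by
  rw [Finset.prod_congr rfl hgh, Finset.prod_neg]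

lemma Aterm (n r p : ℕ) (lam eta : Fin n → K) (f : Fin r → Fin n) (f' : Fin p → Fin n)
    (e : Fin r ⊕ Fin p ≃ Fin n) (he : ∀ c, e c = Sum.elim f f' c)
    (α : Fin r → ℕ) (β : Fin p → ℕ)
    (h1 : ∀ i, eta (f i) = lam (f i) + α i) (h2 : ∀ k, eta (f' k) = lam (f' k) - 1 - β k)
    (d : Fin r → ℕ) :
    (∏ I : Fin r, ∏ J ∈ Finset.univ.filter (fun J => J ≠ I),
        ratioR (lam (f I) - lam (f J)) ((d I : ℤ) - (d J : ℤ))) *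
    ∏ I : Fin r,
      (∏ a : Fin n, ∏ l ∈ Finset.range (d I), (eta a - lam (f I) - (l : K))) /
      (∏ F : Fin n, ∏ l ∈ Finset.range (d I), (lam (f I) - lam F + ((l : K) + 1)))
    = ((-1) ^ p) ^ (∑ i, d i) * wd (fun i => lam (f i)) (fun k => - lam (f' k)) α β d := by
  rw [wd, ← Finset.prod_pow_eq_pow_sum, mul_left_comm]
  refine congrArg₂ (· * ·) rfl ?_
  rw [← Finset.prod_mul_distrib]
  refine Finset.prod_congr rfl fun I _ => ?_
  rw [← e.prod_comp, ← e.prod_comp, Fintype.prod_sum_type, Fintype.prod_sum_type, mul_div_assoc']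
  simp only [he, Sum.elim_inl, Sum.elim_inr, h1, h2]
  congr 1
  · rw [mul_left_comm]
    congr 1
    have : ((-1 : K) ^ p) ^ d I = ∏ k : Fin p, (-1) ^ d I := by
      simp [← pow_mul, mul_comm]
    rw [this, ← Finset.prod_mul_distrib]
    refine Finset.prod_congr rfl fun k _ => ?_
    rw [prod_neg_pow (h := fun l : ℕ => lam (f I) + -lam (f' k) + (l : K) + β k + 1)]
    · simp
    · intro l _; ring
  · congr 1
    refine Finset.prod_congr rfl fun k _ => Finset.prod_congr rfl fun l _ => ?_
    ring

lemma Bterm (n r p : ℕ) (lam eta : Fin n → K) (f : Fin r → Fin n) (f' : Fin p → Fin n)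
    (e : Fin r ⊕ Fin p ≃ Fin n) (he : ∀ c, e c = Sum.elim f f' c)
    (α : Fin r → ℕ) (β : Fin p → ℕ)
    (h1 : ∀ i, eta (f i) = lam (f i) + α i) (h2 : ∀ k, eta (f' k) = lam (f' k) - 1 - β k)
    (d : Fin p → ℕ) :
    (∏ I : Fin p, ∏ J ∈ Finset.univ.filter (fun J => J ≠ I),
        ratioR (lam (f' I) - lam (f' J)) ((d J : ℤ) - (d I : ℤ))) *
    ∏ I : Fin p,
      (∏ a : Fin n, ∏ l ∈ Finset.range (d I), (eta a - lam (f' I) + ((l : K) + 1))) /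
      (∏ F : Fin n, ∏ l ∈ Finset.range (d I), (lam F - lam (f' I) + ((l : K) + 1)))
    = ((-1) ^ p) ^ (∑ i, d i) * wd (fun k => - lam (f' k)) (fun i => lam (f i)) β α d := by
  rw [wd, ← Finset.prod_pow_eq_pow_sum, mul_left_comm]
  refine congrArg₂ (· * ·) ?_ ?_
  · rw [Finset.prod_comm' (t' := univ) (s' := fun J => univ.filter (fun I => I ≠ J))]
    · refine Finset.prod_congr rfl fun I _ => Finset.prod_congr rfl fun J _ => ?_
      congr 1
      ring
    · intro i j; simp [ne_comm]
  rw [← Finset.prod_mul_distrib]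
  refine Finset.prod_congr rfl fun I _ => ?_
  rw [← e.prod_comp, ← e.prod_comp, Fintype.prod_sum_type, Fintype.prod_sum_type, mul_div_assoc']
  simp only [he, Sum.elim_inl, Sum.elim_inr, h1, h2]
  congr 1
  · rw [← mul_assoc, mul_comm]
    congr 1
    · have : ((-1 : K) ^ p) ^ d I = ∏ k : Fin p, (-1) ^ d I := by
        simp [← pow_mul, mul_comm]
      rw [this, ← Finset.prod_mul_distrib]
      refine Finset.prod_congr rfl fun k _ => ?_
      rw [prod_neg_pow (h := fun l : ℕ => -lam (f' k) + β k - - lam (f' I) - (l : K))]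
      · simp
      · intro l _; ring
    · refine Finset.prod_congr rfl fun k _ => Finset.prod_congr rfl fun l _ => ?_
      ring
  · rw [mul_comm]
    congr 1
    · refine Finset.prod_congr rfl fun k _ => Finset.prod_congr rfl fun l _ => ?_
      ring
    · refine Finset.prod_congr rfl fun k _ => Finset.prod_congr rfl fun l _ => ?_
      ring

lemma binom_nat [CharZero K] (s k : ℕ) :
    (∏ j ∈ range k, ((s : K) - j)) / (k.factorial : K) = s.choose k := by
  have h : (∏ j ∈ range k, ((s : K) - j)) = s.descFactorial k := by
    induction k with
    | zero => simp
    | succ k ih =>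
      rw [Finset.prod_range_succ, ih, Nat.descFactorial_succ, mul_comm]
      rcases le_or_gt k s with h | h
      · push_cast [Nat.cast_sub h]; ring
      · rw [Nat.descFactorial_eq_zero_iff_lt.2 h]; simp
  rw [h, Nat.descFactorial_eq_factorial_mul_choose]
  have : (k.factorial : K) ≠ 0 := by exact_mod_cast k.factorial_ne_zero
  push_cast
  field_simp

/-- polynomial functions -/
def IsPF {σ : Type*} (φ : (σ → K) → K) : Prop :=
  ∃ p : MvPolynomial σ K, ∀ t, φ t = MvPolynomial.eval t p

namespace IsPF
variable {σ : Type*}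
lemma const (c : K) : IsPF (fun _ : σ → K => c) := ⟨MvPolynomial.C c, by simp⟩
lemma coord (i : σ) : IsPF (fun t : σ → K => t i) := ⟨MvPolynomial.X i, by simp⟩
lemma add {φ ψ : (σ → K) → K} (h : IsPF φ) (h' : IsPF ψ) : IsPF (fun t => φ t + ψ t) := by
  obtain ⟨p, hp⟩ := h
  obtain ⟨q, hq⟩ := h'
  exact ⟨p + q, by simp [hp, hq]⟩
lemma mul {φ ψ : (σ → K) → K} (h : IsPF φ) (h' : IsPF ψ) : IsPF (fun t => φ t * ψ t) := by
  obtain ⟨p, hp⟩ := h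
  obtain ⟨q, hq⟩ := h'
  exact ⟨p * q, by simp [hp, hq]⟩
lemma sub {φ ψ : (σ → K) → K} (h : IsPF φ) (h' : IsPF ψ) : IsPF (fun t => φ t - ψ t) := by
  obtain ⟨p, hp⟩ := h
  obtain ⟨q, hq⟩ := h'
  exact ⟨p - q, by simp [hp, hq]⟩
lemma div {φ : (σ → K) → K} (h : IsPF φ) (c : K) : IsPF (fun t => φ t / c) := by
  simp_rw [div_eq_mul_inv]
  exact h.mul (const _)
lemma sum {ι : Type*} (S : Finset ι) {φ : ι → (σ → K) → K} (h : ∀ i ∈ S, IsPF (φ i)) :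
    IsPF (fun t => ∑ i ∈ S, φ i t) := by
  classical
  induction S using Finset.induction_on with
  | empty => simpa using const 0
  | insert a S ha ih =>
    simp_rw [Finset.sum_insert ha]
    exact (h a (by simp)).add (ih fun i hi => h i (by simp [hi]))
lemma prod {ι : Type*} (S : Finset ι) {φ : ι → (σ → K) → K} (h : ∀ i ∈ S, IsPF (φ i)) :
    IsPF (fun t => ∏ i ∈ S, φ i t) := by
  classical
  induction S using Finset.induction_on with
  | empty => simpa using const 1
  | insert a S ha ih =>
    simp_rw [Finset.prod_insert ha]
    exact (h a (by simp)).mul (ih fun i hi => h i (by simp [hi]))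

lemma ext [CharZero K] {φ ψ : (σ → K) → K} (h : IsPF φ) (h' : IsPF ψ)
    (heq : ∀ T : σ → ℕ, φ (fun i => T i) = ψ (fun i => T i)) : φ = ψ := by
  obtain ⟨p, hp⟩ := h
  obtain ⟨q, hq⟩ := h'
  have : p = q := by
    apply MvPolynomial.funext_set (fun _ => Set.range (fun n : ℕ => (n : K)))
    · intro i
      exact Set.infinite_range_of_injective Nat.cast_injective
    · intro x hx
      choose T hT using fun i => hx i (Set.mem_univ i)
      have hx' : x = fun i => (T i : K) := funext fun i => (hT i).symm
      rw [hx', ← hp, ← hq]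
      exact heq T
  funext t
  rw [hp, hq, this]
end IsPF

end part5

/-- Seiberg duality for the fundamental building block, case `n = m`:
`A(q) = (1 + (-1)^{n-r} q)^α · B(q)` in `K⟦q⟧`, where
`α = Σ_A η_A − Σ_F λ_F + (n-r)` and the generalized binomial series
`(1 + (-1)^{n-r} q)^α` has `k`-th coefficient `(∏_{j=0}^{k-1}(α−j)/k!) · ((-1)^{n-r})^k`. -/
theorem seiberg_duality_building_block_case3 {K : Type*} [Field K] [CharZero K]
    (n r m : ℕ) (hr : 1 ≤ r) (hrn : r + 1 ≤ n) (hnm : n = m)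
    (lam : Fin n → K) (eta : Fin m → K)
    (hlam : ∀ i j : Fin n, i ≠ j → ∀ z : ℤ, lam i - lam j ≠ (z : K))
    (f : Fin r → Fin n) (hf : StrictMono f)
    (f' : Fin (n - r) → Fin n) (hf' : StrictMono f')
    (hcompl : ∀ j : Fin n, (∃ i, f i = j) ↔ ¬ ∃ i, f' i = j) :
    Aseries n r m lam eta f =
      (PowerSeries.mk fun k =>
        (∏ j ∈ Finset.range k,
            ((∑ a : Fin m, eta a) - (∑ F : Fin n, lam F) + ((n - r : ℕ) : K) - (j : K))) /
          (Nat.factorial k : K) * ((-1 : K) ^ (n - r)) ^ k) *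
        Bseries n r m lam eta f' := by

  subst hnm
  set e := eqv n r f hf f' hf' hcompl with hedef
  have he : ∀ c, e c = Sum.elim f f' c := fun c => rfl
  let i0 : Fin r := ⟨0, hr⟩
  -- the parametrization of the etas
  let H : (Fin r ⊕ Fin (n - r) → K) → Fin r ⊕ Fin (n - r) → K := fun t =>
    Sum.elim (fun i => lam (f i) + (t (Sum.inl i) + (if i = i0 then 1 else 0) * ∑ k, t (Sum.inr k)))
      (fun k => lam (f' k) - 1 - t (Sum.inr k))
  let E : (Fin r ⊕ Fin (n - r) → K) → Fin n → K := fun t F => H t (e.symm F)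
  have hEf : ∀ t i, E t (f i) =
      lam (f i) + (t (Sum.inl i) + (if i = i0 then 1 else 0) * ∑ k, t (Sum.inr k)) := by
    intro t i
    have : e.symm (f i) = Sum.inl i := by rw [Equiv.symm_apply_eq, he]; rfl
    simp only [E, this]; rfl
  have hEf' : ∀ t k, E t (f' k) = lam (f' k) - 1 - t (Sum.inr k) := by
    intro t i
    have : e.symm (f' i) = Sum.inr i := by rw [Equiv.symm_apply_eq, he]; rfl
    simp only [E, this]; rfl
  have hEP : ∀ F, IsPF (fun t => E t F) := by
    intro F
    obtain ⟨c, rfl⟩ := e.surjective F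
    rcases c with i | k
    · simp only [he, Sum.elim_inl, hEf]
      exact (IsPF.const _).add ((IsPF.coord _).add ((IsPF.const _).mul
        (IsPF.sum _ fun k _ => IsPF.coord _)))
    · simp only [he, Sum.elim_inr, hEf']
      exact (IsPF.const _).sub (IsPF.coord _)
  have hsurj : ∃ t, E t = eta := by
    let t : Fin r ⊕ Fin (n - r) → K := Sum.elim
      (fun i => eta (f i) - lam (f i) -
        (if i = i0 then 1 else 0) * ∑ k, (lam (f' k) - 1 - eta (f' k)))
      (fun k => lam (f' k) - 1 - eta (f' k))
    refine ⟨t, ?_⟩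
    funext F
    obtain ⟨c, rfl⟩ := e.surjective F
    rcases c with i | k
    · simp only [he, Sum.elim_inl, hEf, t, Sum.elim_inr]
      ring
    · simp only [he, Sum.elim_inr, hEf', t]
      ring
  obtain ⟨t, rfl⟩ := hsurj
  ext N
  rw [PowerSeries.coeff_mul]
  simp only [Aseries, Bseries, PowerSeries.coeff_mk]
  revert t
  rw [← funext_iff]
  apply IsPF.ext
  · refine IsPF.sum _ fun d _ => (IsPF.const _).mul (IsPF.prod _ fun I _ => IsPF.div ?_ _)
    exact IsPF.prod _ fun a _ => IsPF.prod _ fun l _ =>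
      ((hEP a).sub (IsPF.const _)).sub (IsPF.const _)
  · refine IsPF.sum _ fun x _ => IsPF.mul ?_ ?_
    · refine (IsPF.div (IsPF.prod _ fun j _ => ?_) _).mul (IsPF.const _)
      exact (((IsPF.sum _ fun a _ => hEP a).sub (IsPF.const _)).add (IsPF.const _)).sub
        (IsPF.const _)
    · refine IsPF.sum _ fun d _ => (IsPF.const _).mul (IsPF.prod _ fun I _ => IsPF.div ?_ _)
      exact IsPF.prod _ fun a _ => IsPF.prod _ fun l _ =>
        ((hEP a).sub (IsPF.const _)).add (IsPF.const _)
  intro T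
  let α : Fin r → ℕ := fun i =>
    T (Sum.inl i) + (if i = i0 then 1 else 0) * ∑ k, T (Sum.inr k)
  let β : Fin (n - r) → ℕ := fun k => T (Sum.inr k)
  let s : ℕ := ∑ i, T (Sum.inl i)
  set tt : Fin r ⊕ Fin (n - r) → K := fun i => (T i : K) with htt
  have h1 : ∀ i, E tt (f i) = lam (f i) + α i := by
    intro i
    rw [hEf]
    simp only [α, htt]
    push_cast
    rfl
  have h2 : ∀ k, E tt (f' k) = lam (f' k) - 1 - β k := by
    intro k
    rw [hEf']
  have hs : ∑ i, α i = ∑ k, β k + s := by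
    simp only [α, β, s, Finset.sum_add_distrib]
    rw [← Finset.sum_mul]
    simp [add_comm]
  have hsK : (∑ a, E tt a) - ∑ F, lam F + ((n - r : ℕ) : K) = s := by
    rw [← e.sum_comp, ← e.sum_comp lam, Fintype.sum_sum_type, Fintype.sum_sum_type]
    simp only [he, Sum.elim_inl, Sum.elim_inr, h1, h2, Finset.sum_add_distrib,
      Finset.sum_sub_distrib]
    have := congrArg (Nat.cast : ℕ → K) hs
    push_cast at this
    rw [this]
    simp
    ring
  have hff' : ∀ i k, f i ≠ f' k := fun i k h => (hcompl (f i)).1 ⟨i, rfl⟩ ⟨k, h.symm⟩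
  have key := special (fun i => lam (f i)) (fun k => - lam (f' k)) α β s hs
    (fun i j hij => hlam _ _ (hf.injective.ne hij))
    (fun i j hij z => by
      rw [neg_sub_neg]; exact hlam _ _ (hf'.injective.ne hij.symm) z)
    (fun i k z => by rw [← sub_eq_add_neg]; exact hlam _ _ (hff' i k) z) N
  simp only [Aterm n r (n - r) lam (E tt) f f' e he α β h1 h2,
    Bterm n r (n - r) lam (E tt) f f' e he α β h1 h2, hsK, binom_nat]
  have hA' : ∀ (ε : K) (r N : ℕ) (g : (Fin r → ℕ) → K),
      ∑ d ∈ Finset.Nat.antidiagonalTuple r N, ε ^ (∑ i, d i) * g d =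
      ε ^ N * ∑ d ∈ Finset.Nat.antidiagonalTuple r N, g d := by
    intro ε r N g
    rw [Finset.mul_sum]
    refine Finset.sum_congr rfl fun d hd => ?_
    rw [Finset.Nat.mem_antidiagonalTuple.1 hd]
  simp only [hA']
  rw [key, Finset.mul_sum]
  refine Finset.sum_congr rfl fun x hx => ?_
  have hx' : x.1 + x.2 = N := by simpa using hx
  have hp : (((-1 : K) ^ (n - r)) ^ N) = ((-1 : K) ^ (n - r)) ^ x.1 * ((-1 : K) ^ (n - r)) ^ x.2 := by
    rw [← pow_add, hx']
  rw [hp]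
  ring
end

section
/- The map ι_1 sending (C_1, C_2, D) ∈ 𝔉_1 to ({1,…,N_4} \ C_1, C_2, D) is a well-defined bijection from 𝔉_1 onto 𝔉_2 (the bijection of Lemma 5.4 between the torus fixed points of Z_1 and of Z_2). -/
/-- The torus fixed locus `𝔉₁` of the mutated `D₃`-type quiver variety `Z₁`
(with `N₄ = N₁ + N₂` and `N₃' = N₄ − N₃`): triples `(C₁, C₂, D)` of subsets of
`{1,…,N₄}` with `|C₁| = N₁`, `|C₂| = N₂`, `|D| = N₃'`, `C₁, C₂ ⊆ {1,…,N₄} \ D`. -/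
def D3F1 (N1 N2 N3 : ℕ) :
    Set (Finset (Fin (N1 + N2)) × Finset (Fin (N1 + N2)) × Finset (Fin (N1 + N2))) :=
  {C | C.1.card = N1 ∧ C.2.1.card = N2 ∧ C.2.2.card = N1 + N2 - N3 ∧
       C.1 ⊆ C.2.2ᶜ ∧ C.2.1 ⊆ C.2.2ᶜ}

/-- The torus fixed locus `𝔉₂` of the twice-mutated `D₃`-type quiver variety `Z₂`:
triples `(A, B, C)` of subsets of `{1,…,N₄}` with `|A| = N₂`, `|B| = N₂`,
`|C| = N₃'`, `C ⊆ A` and `C ∩ B = ∅`. -/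
def D3F2 (N1 N2 N3 : ℕ) :
    Set (Finset (Fin (N1 + N2)) × Finset (Fin (N1 + N2)) × Finset (Fin (N1 + N2))) :=
  {C | C.1.card = N2 ∧ C.2.1.card = N2 ∧ C.2.2.card = N1 + N2 - N3 ∧
       C.2.2 ⊆ C.1 ∧ C.2.2 ∩ C.2.1 = ∅}

/-- Lemma 5.4 (bijection): the map `ι₁` sending `(C₁, C₂, D)` to
`({1,…,N₄} \ C₁, C₂, D)` is a well-defined bijection from `𝔉₁` onto `𝔉₂`. -/
theorem D3_fixed_locus_bijection_Z1_Z2 (N1 N2 N3 : ℕ)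
    (h13 : N1 ≤ N3) (h23 : N2 ≤ N3) (h3 : N3 ≤ N1 + N2) :
    Set.BijOn
      (fun C : Finset (Fin (N1 + N2)) × Finset (Fin (N1 + N2)) × Finset (Fin (N1 + N2)) =>
        (C.1ᶜ, C.2.1, C.2.2))
      (D3F1 N1 N2 N3) (D3F2 N1 N2 N3) := by
  have hc : ∀ A : Finset (Fin (N1 + N2)), Aᶜ.card = N1 + N2 - A.card := by
    intro A
    rw [Finset.card_compl, Fintype.card_fin]
  refine ⟨?_, ?_, ?_⟩
  · rintro ⟨A, B, D⟩ ⟨h1, h2, h4, h5, h6⟩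
    dsimp only at h1 h2 h4 h5 h6
    refine ⟨?_, h2, h4, ?_, ?_⟩
    · have := hc A
      dsimp only
      omega
    · intro x hx
      rw [Finset.mem_compl]
      intro hA
      exact (Finset.mem_compl.1 (h5 hA)) hx
    · ext x
      simp only [Finset.mem_inter, Finset.notMem_empty, iff_false]
      rintro ⟨hx, hB⟩
      exact (Finset.mem_compl.1 (h6 hB)) hx
  · rintro ⟨A, B, D⟩ _ ⟨A', B', D'⟩ _ h
    simpa using h
  · rintro ⟨A, B, D⟩ ⟨h1, h2, h4, h5, h6⟩
    dsimp only at h1 h2 h4 h5 h6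
    refine ⟨(Aᶜ, B, D), ⟨?_, h2, h4, ?_, ?_⟩, by simp⟩
    · have := hc A
      dsimp only
      omega
    · intro x hx
      rw [Finset.mem_compl]
      intro hD
      exact (Finset.mem_compl.1 hx) (h5 hD)
    · intro x hx
      rw [Finset.mem_compl]
      intro hD
      have : x ∈ D ∩ B := Finset.mem_inter.2 ⟨hD, hx⟩
      rw [h6] at this
      simp at this
end
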